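/- Let S ⊆ ℝ² satisfy (H2) and in addition be bounded and not a singleton. Then S is a regular simple closed curve of class C²; that is, S is a compact connected 1-dimensional C² manifold without boundary, hence C²-diffeomorphic to the circle. -/

import Mathlib

open Metric Set Real

noncomputable section

abbrev E2 := EuclideanSpace ℝ (Fin 2)

/-- The point of the Euclidean plane with coordinates `(a, b)`. -/
def pt (a b : ℝ) : E2 := (EuclideanSpace.equiv (Fin 2) ℝ).symm ![a, b]

/-- `S` is, near `p`, in suitable orthonormal coordinates (i.e. up to a rigid motion `e`),
the graph of a `C²` function over an open interval. -/
def IsC2GraphAt (S : Set E2) (p : E2) : Prop :=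
  ∃ (e : E2 ≃ᵃⁱ[ℝ] E2) (U : Set E2) (g : ℝ → ℝ) (a b : ℝ),
    IsOpen U ∧ p ∈ U ∧ a < b ∧ ContDiff ℝ 2 g ∧
    e '' (S ∩ U) = (fun t => pt t (g t)) '' Set.Ioo a b

section ProximallySmoothCurves

open Filter Topology

/-! ### The plane -/

@[simp] lemma pt_apply_zero (a b : ℝ) : pt a b 0 = a := rfl

@[simp] lemma pt_apply_one (a b : ℝ) : pt a b 1 = b := rfl

lemma inner_eq_coord (x y : E2) : inner ℝ x y = x 0 * y 0 + x 1 * y 1 := by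
  simp [PiLp.inner_apply, Fin.sum_univ_two, mul_comm]

/-- Rotation of the plane by a right angle. -/
def rot : E2 →L[ℝ] E2 :=
  LinearMap.toContinuousLinearMap
    { toFun := fun x => pt (-x 1) (x 0)
      map_add' := fun x y => by
        ext i; fin_cases i <;> simp [add_comm]
      map_smul' := fun c x => by
        ext i; fin_cases i <;> simp }

@[simp] lemma rot_apply_zero (x : E2) : rot x 0 = -x 1 := rfl

@[simp] lemma rot_apply_one (x : E2) : rot x 1 = x 0 := rfl

@[simp] lemma inner_rot_rot (x y : E2) : inner ℝ (rot x) (rot y) = inner ℝ x y := by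
  simp only [inner_eq_coord, rot_apply_zero, rot_apply_one]; ring

@[simp] lemma inner_self_rot (x : E2) : inner ℝ x (rot x) = 0 := by
  simp only [inner_eq_coord, rot_apply_zero, rot_apply_one]; ring

@[simp] lemma norm_rot (x : E2) : ‖rot x‖ = ‖x‖ := by
  have h := inner_rot_rot x x
  rw [real_inner_self_eq_norm_sq, real_inner_self_eq_norm_sq] at h
  exact (sq_eq_sq₀ (norm_nonneg _) (norm_nonneg _)).1 h

lemma inner_self_of_norm_one {v : E2} (hv : ‖v‖ = 1) : inner ℝ v v = 1 := by
  rw [real_inner_self_eq_norm_sq, hv, one_pow]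

lemma eq_inner_smul_add {v : E2} (hv : ‖v‖ = 1) (u : E2) :
    u = inner ℝ v u • v + inner ℝ (rot v) u • rot v := by
  have h := inner_self_of_norm_one hv
  rw [inner_eq_coord] at h
  ext i
  fin_cases i
  · simp only [inner_eq_coord, rot_apply_zero, rot_apply_one, PiLp.add_apply, PiLp.smul_apply,
      smul_eq_mul, Fin.zero_eta]
    linear_combination (-u 0) * h
  · simp only [inner_eq_coord, rot_apply_zero, rot_apply_one, PiLp.add_apply, PiLp.smul_apply,
      smul_eq_mul, Fin.mk_one]
    linear_combination (-u 1) * h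

lemma norm_sub_smul_sq {v : E2} (hv : ‖v‖ = 1) (u : E2) (t : ℝ) :
    ‖u - t • v‖ ^ 2 = ‖u‖ ^ 2 - 2 * t * inner ℝ u v + t ^ 2 := by
  rw [norm_sub_sq_real, real_inner_smul_right, norm_smul, hv]
  simp only [Real.norm_eq_abs, mul_one, sq_abs]
  ring

lemma norm_smul_of_norm_one {v : E2} (hv : ‖v‖ = 1) {t : ℝ} (ht : 0 ≤ t) : ‖t • v‖ = t := by
  rw [norm_smul, hv, mul_one, Real.norm_of_nonneg ht]

/-! ### The distance function from a proximally `C²` set -/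

/-- `S` is a nonempty closed set that is proximally `C²` of radius `r`. -/
structure ProxC2 (S : Set E2) (r : ℝ) : Prop where
  pos : 0 < r
  nonempty : S.Nonempty
  closed : IsClosed S
  smooth : ContDiffOn ℝ 2 (fun x => infDist x S) {x | 0 < infDist x S ∧ infDist x S < r}

/-- The punctured open tubular neighbourhood of radius `r` of `S`. -/
def tube (S : Set E2) (r : ℝ) : Set E2 := {x | 0 < infDist x S ∧ infDist x S < r}

/-- The gradient of the distance function from `S`. -/
def distGrad (S : Set E2) (x : E2) : E2 :=
  pt (fderiv ℝ (fun y => infDist y S) x (pt 1 0)) (fderiv ℝ (fun y => infDist y S) x (pt 0 1))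

/-- The derivative of the gradient of the distance function from `S`. -/
def distHess (S : Set E2) (x : E2) : E2 →L[ℝ] E2 := fderiv ℝ (distGrad S) x

/-- The projection to `S` along the gradient of the distance function. -/
def proj (S : Set E2) (x : E2) : E2 := x - infDist x S • distGrad S x

/-- The curvature of the level line of the distance function through `x`. -/
def curv (S : Set E2) (x : E2) : ℝ :=
  inner ℝ (distHess S x (rot (distGrad S x))) (rot (distGrad S x))

/-- The factor by which `proj S` scales tangent vectors of the level line through `x`. -/
def scale (S : Set E2) (x : E2) : ℝ := 1 - infDist x S * curv S x

/-- `v` is a unit vector, and `p` is the nearest point of `S` along the ray of length `r` from `p`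
in the direction `v`. -/
def IsNormal (S : Set E2) (r : ℝ) (p v : E2) : Prop :=
  ‖v‖ = 1 ∧ ∀ t ∈ Ico 0 r, infDist (p + t • v) S = t

variable {S : Set E2} {r : ℝ} {x p q v w : E2} {t : ℝ}

lemma inner_distGrad (x u : E2) :
    inner ℝ (distGrad S x) u = fderiv ℝ (fun y => infDist y S) x u := by
  have hu : u = u 0 • pt 1 0 + u 1 • pt 0 1 := by
    ext i; fin_cases i <;> simp
  conv_rhs => rw [hu]
  rw [map_add, map_smul, map_smul, inner_eq_coord]
  simp [distGrad, mul_comm]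

lemma isOpen_tube : IsOpen (tube S r) :=
  (isOpen_lt continuous_const (continuous_infDist_pt S)).inter
    (isOpen_lt (continuous_infDist_pt S) continuous_const)

namespace ProxC2

lemma contDiffAt (h : ProxC2 S r) (hx : x ∈ tube S r) :
    ContDiffAt ℝ 2 (fun y => infDist y S) x :=
  h.smooth.contDiffAt (isOpen_tube.mem_nhds hx)

lemma hasFDerivAt_infDist (h : ProxC2 S r) (hx : x ∈ tube S r) :
    HasFDerivAt (fun y => infDist y S) (innerSL ℝ (distGrad S x)) x := by
  have h1 := ((h.contDiffAt hx).differentiableAt (by norm_num)).hasFDerivAt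
  refine h1.congr_fderiv ?_
  ext1 u
  rw [innerSL_apply_apply, inner_distGrad]

lemma contDiffAt_distGrad (h : ProxC2 S r) (hx : x ∈ tube S r) :
    ContDiffAt ℝ 1 (distGrad S) x := by
  have h1 : ContDiffAt ℝ 1 (fderiv ℝ (fun y => infDist y S)) x :=
    (h.contDiffAt hx).fderiv_right (by norm_num)
  rw [contDiffAt_euclidean]
  intro i
  fin_cases i
  · exact h1.clm_apply contDiffAt_const
  · exact h1.clm_apply contDiffAt_const

lemma hasFDerivAt_distGrad (h : ProxC2 S r) (hx : x ∈ tube S r) :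
    HasFDerivAt (distGrad S) (distHess S x) x :=
  ((h.contDiffAt_distGrad hx).differentiableAt (by norm_num)).hasFDerivAt

lemma continuousAt_distGrad (h : ProxC2 S r) (hx : x ∈ tube S r) : ContinuousAt (distGrad S) x :=
  (h.contDiffAt_distGrad hx).continuousAt

lemma continuousAt_distHess (h : ProxC2 S r) (hx : x ∈ tube S r) : ContinuousAt (distHess S) x :=
  ((h.contDiffAt_distGrad hx).fderiv_right (m := 0) (by norm_num)).continuousAt

lemma continuousAt_curv (h : ProxC2 S r) (hx : x ∈ tube S r) : ContinuousAt (curv S) x :=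
  have h1 := rot.continuous.continuousAt.comp (h.continuousAt_distGrad hx)
  ((h.continuousAt_distHess hx).clm_apply h1).inner h1

lemma continuousAt_scale (h : ProxC2 S r) (hx : x ∈ tube S r) : ContinuousAt (scale S) x :=
  continuousAt_const.sub ((continuous_infDist_pt S).continuousAt.mul (h.continuousAt_curv hx))

lemma inner_distHess (h : ProxC2 S r) (hx : x ∈ tube S r) (u w : E2) :
    inner ℝ (distHess S x u) w = fderiv ℝ (fderiv ℝ (fun y => infDist y S)) x u w := by
  have h1 : HasFDerivAt (fun y => inner ℝ (distGrad S y) w)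
      ((innerSL ℝ w).comp (distHess S x)) x := by
    have := (innerSL ℝ w).hasFDerivAt.comp x (h.hasFDerivAt_distGrad hx)
    refine this.congr_of_eventuallyEq (Eventually.of_forall fun y => ?_)
    simp [real_inner_comm]
  have h2 : DifferentiableAt ℝ (fderiv ℝ (fun y => infDist y S)) x :=
    ((h.contDiffAt hx).fderiv_right (m := 1) (by norm_num)).differentiableAt (by norm_num)
  have h3 := h2.hasFDerivAt.clm_apply (hasFDerivAt_const w x)
  simp only [inner_distGrad] at h1
  have h4 := congrArg (fun L => L u) (h1.unique h3)
  simpa [real_inner_comm] using h4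

lemma inner_distHess_comm (h : ProxC2 S r) (hx : x ∈ tube S r) (u w : E2) :
    inner ℝ (distHess S x u) w = inner ℝ (distHess S x w) u := by
  rw [h.inner_distHess hx, h.inner_distHess hx]
  exact ((h.contDiffAt hx).isSymmSndFDerivAt (by simp)).eq u w

lemma sub_eq_smul_distGrad (h : ProxC2 S r) (hx : x ∈ tube S r) {y : E2} (hy : y ∈ S)
    (hxy : infDist x S = dist x y) :
    ‖distGrad S x‖ = 1 ∧ x - y = infDist x S • distGrad S x := by
  set d := infDist x S with hd
  have hd0 : 0 < d := hx.1
  set u : E2 := d⁻¹ • (x - y) with hu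
  have hxu : x - y = d • u := by rw [hu, smul_smul, mul_inv_cancel₀ hd0.ne', one_smul]
  have hun : ‖u‖ = 1 := by
    rw [hu, norm_smul, ← dist_eq_norm, ← hxy, norm_inv, Real.norm_of_nonneg hd0.le,
      inv_mul_cancel₀ hd0.ne']
  have hline : ∀ τ ∈ Icc 0 d, infDist (x + τ • (-u)) S = d - τ := by
    intro τ hτ
    apply le_antisymm
    · refine (infDist_le_dist_of_mem hy).trans ?_
      rw [dist_eq_norm, show x + τ • (-u) - y = (d - τ) • u by rw [sub_smul, ← hxu]; module,
        norm_smul_of_norm_one hun (sub_nonneg.2 hτ.2)]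
    · have := infDist_le_infDist_add_dist (s := S) (x := x) (y := x + τ • (-u))
      rw [dist_eq_norm, show x - (x + τ • (-u)) = τ • u by module,
        norm_smul_of_norm_one hun hτ.1] at this
      linarith
  have h1 : HasDerivAt (fun τ : ℝ => infDist (x + τ • (-u)) S)
      (inner ℝ (distGrad S x) (-u)) 0 := by
    have hl : HasDerivAt (fun τ : ℝ => x + τ • (-u)) (-u) 0 := by
      simpa using ((hasDerivAt_id (0 : ℝ)).smul_const (-u)).const_add x
    have := (h.hasFDerivAt_infDist hx)
    rw [show x = x + (0 : ℝ) • (-u) by simp] at this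
    have h4 := this.comp_hasDerivAt (0 : ℝ) hl
    rw [innerSL_apply_apply, zero_smul, add_zero] at h4
    exact h4
  have h2 : HasDerivWithinAt (fun τ : ℝ => infDist (x + τ • (-u)) S) (-1) (Icc 0 d) 0 := by
    have : HasDerivWithinAt (fun τ : ℝ => d - τ) (-1) (Icc 0 d) 0 := by
      simpa using ((hasDerivAt_id (0 : ℝ)).const_sub d).hasDerivWithinAt
    exact this.congr hline (hline 0 ⟨le_rfl, hd0.le⟩)
  have h3 : inner ℝ (distGrad S x) u = 1 := by
    have := (uniqueDiffOn_Icc hd0 0 ⟨le_rfl, hd0.le⟩).eq_deriv _ h1.hasDerivWithinAt h2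
    rw [inner_neg_right] at this
    linarith
  have h4 : ‖distGrad S x‖ ≤ 1 := by
    have hL := norm_fderiv_le_of_lipschitz ℝ (x₀ := x) (lipschitz_infDist_pt S)
    rw [(h.hasFDerivAt_infDist hx).fderiv, innerSL_apply_norm] at hL
    simpa using hL
  have h5 : distGrad S x = u := by
    have : ‖distGrad S x - u‖ ^ 2 ≤ 0 := by
      rw [norm_sub_sq_real, h3, hun]
      nlinarith [norm_nonneg (distGrad S x)]
    have : ‖distGrad S x - u‖ = 0 := by
      nlinarith [norm_nonneg (distGrad S x - u)]
    exact sub_eq_zero.1 (norm_eq_zero.1 this)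
  rw [h5]
  exact ⟨hun, hxu⟩

lemma norm_distGrad (h : ProxC2 S r) (hx : x ∈ tube S r) : ‖distGrad S x‖ = 1 := by
  obtain ⟨y, hy, hxy⟩ := h.closed.exists_infDist_eq_dist h.nonempty x
  exact (h.sub_eq_smul_distGrad hx hy hxy).1

lemma proj_eq (h : ProxC2 S r) (hx : x ∈ tube S r) {y : E2} (hy : y ∈ S)
    (hxy : infDist x S = dist x y) : proj S x = y := by
  rw [proj, ← (h.sub_eq_smul_distGrad hx hy hxy).2, sub_sub_cancel]

lemma proj_mem (h : ProxC2 S r) (hx : x ∈ tube S r) : proj S x ∈ S := by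
  obtain ⟨y, hy, hxy⟩ := h.closed.exists_infDist_eq_dist h.nonempty x
  rwa [h.proj_eq hx hy hxy]

lemma dist_proj (h : ProxC2 S r) (hx : x ∈ tube S r) : dist x (proj S x) = infDist x S := by
  obtain ⟨y, hy, hxy⟩ := h.closed.exists_infDist_eq_dist h.nonempty x
  rw [h.proj_eq hx hy hxy, hxy]

lemma inner_distHess_distGrad (h : ProxC2 S r) (hx : x ∈ tube S r) (u : E2) :
    inner ℝ (distHess S x u) (distGrad S x) = 0 := by
  have h1 := (h.hasFDerivAt_distGrad hx).inner ℝ (h.hasFDerivAt_distGrad hx)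
  have h2 : (fun y => inner ℝ (distGrad S y) (distGrad S y)) =ᶠ[𝓝 x] fun _ => (1 : ℝ) := by
    filter_upwards [isOpen_tube.mem_nhds hx] with y hy
    exact inner_self_of_norm_one (h.norm_distGrad hy)
  have h3 := congrArg (fun L => L u)
    (h1.unique ((hasFDerivAt_const (1 : ℝ) x).congr_of_eventuallyEq h2))
  simp [fderivInnerCLM_apply, real_inner_comm] at h3
  linarith [real_inner_comm (distHess S x u) (distGrad S x)]

lemma distHess_distGrad (h : ProxC2 S r) (hx : x ∈ tube S r) :
    distHess S x (distGrad S x) = 0 := by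
  apply ext_inner_right ℝ
  intro u
  rw [h.inner_distHess_comm hx, h.inner_distHess_distGrad hx, inner_zero_left]

lemma distHess_apply (h : ProxC2 S r) (hx : x ∈ tube S r) (u : E2) :
    distHess S x u = (curv S x * inner ℝ (rot (distGrad S x)) u) • rot (distGrad S x) := by
  have hn := h.norm_distGrad hx
  have h1 : distHess S x u
      = inner ℝ (rot (distGrad S x)) u • distHess S x (rot (distGrad S x)) := by
    conv_lhs => rw [eq_inner_smul_add hn u]
    rw [map_add, map_smul, map_smul, h.distHess_distGrad hx, smul_zero, zero_add]
  have h2 : distHess S x (rot (distGrad S x)) = curv S x • rot (distGrad S x) := by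
    rw [eq_inner_smul_add hn (distHess S x (rot (distGrad S x))), curv,
      real_inner_comm (distHess S x (rot (distGrad S x))) (distGrad S x) ,
      real_inner_comm (distHess S x (rot (distGrad S x))) (rot (distGrad S x)),
      h.inner_distHess_distGrad hx, zero_smul, zero_add]
  rw [h1, h2, smul_smul, mul_comm]

/-- The derivative of `proj S`, applied to a vector. -/
lemma hasFDerivAt_proj (h : ProxC2 S r) (hx : x ∈ tube S r) :
    HasFDerivAt (proj S)
      ((scale S x • innerSL ℝ (rot (distGrad S x))).smulRight (rot (distGrad S x))) x := by
  have h1 := (hasFDerivAt_id x).sub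
    ((h.hasFDerivAt_infDist hx).smul (h.hasFDerivAt_distGrad hx))
  refine h1.congr_fderiv ?_
  ext1 u
  have hn := h.norm_distGrad hx
  simp only [_root_.sub_apply, _root_.add_apply,
    _root_.smul_apply, ContinuousLinearMap.smulRight_apply, innerSL_apply_apply,
    ContinuousLinearMap.id_apply, h.distHess_apply hx, scale, smul_eq_mul]
  nth_rw 1 [eq_inner_smul_add hn u]
  module

end ProxC2

lemma hasDerivAt_line (p v : E2) (t : ℝ) : HasDerivAt (fun τ : ℝ => p + τ • v) v t := by
  simpa using ((hasDerivAt_id t).smul_const v).const_add p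

lemma continuous_line (p v : E2) : Continuous (fun τ : ℝ => p + τ • v) := by fun_prop

lemma IsNormal.mem (hS : IsClosed S) (hne : S.Nonempty) (hr : 0 < r) (h : IsNormal S r p v) :
    p ∈ S := by
  have := h.2 0 ⟨le_rfl, hr⟩
  rw [zero_smul, add_zero] at this
  exact (hS.mem_iff_infDist_zero hne).2 this

lemma IsNormal.mem_tube (h : IsNormal S r p v) (ht : t ∈ Ioo 0 r) : p + t • v ∈ tube S r := by
  have := h.2 t ⟨ht.1.le, ht.2⟩
  exact ⟨this.symm ▸ ht.1, this.symm ▸ ht.2⟩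

namespace ProxC2

lemma proj_add_smul (x : E2) : proj S x + infDist x S • distGrad S x = x := by
  rw [proj, sub_add_cancel]

lemma distGrad_ray_locally (h : ProxC2 S r) (hy : p + t • v ∈ tube S r)
    (hv : distGrad S (p + t • v) = v) :
    ∀ᶠ τ in 𝓝 t, distGrad S (p + τ • v) = v := by
  have hc : ContinuousAt (fun τ : ℝ => p + τ • v) t := (continuous_line p v).continuousAt
  have hA : ContinuousAt (fun τ : ℝ => distHess S (p + τ • v)) t :=
    ContinuousAt.comp (f := fun τ : ℝ => p + τ • v) (h.continuousAt_distHess hy) hc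
  have htube : ∀ᶠ τ in 𝓝 t, p + τ • v ∈ tube S r := hc.eventually (isOpen_tube.mem_nhds hy)
  have hK : ∀ᶠ τ in 𝓝 t, ‖distHess S (p + τ • v)‖₊ < ‖distHess S (p + t • v)‖₊ + 1 :=
    hA.nnnorm.eventually (gt_mem_nhds (by simp))
  have key := ODE_solution_unique_of_eventually (v := fun τ z => -(distHess S (p + τ • v) z))
    (s := fun _ => univ) (K := ‖distHess S (p + t • v)‖₊ + 1)
    (f := fun τ => distGrad S (p + τ • v) - v) (g := fun _ => 0) (t₀ := t) ?_ ?_ ?_ ?_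
  · filter_upwards [key] with τ hτ using sub_eq_zero.1 hτ
  · filter_upwards [hK] with τ hτ
    refine LipschitzWith.lipschitzOnWith (LipschitzWith.of_dist_le_mul fun a b => ?_)
    rw [dist_neg_neg, dist_eq_norm, ← map_sub, dist_eq_norm]
    refine (ContinuousLinearMap.le_opNorm _ _).trans ?_
    exact mul_le_mul_of_nonneg_right hτ.le (norm_nonneg _)
  · filter_upwards [htube] with τ hτ
    refine ⟨?_, mem_univ _⟩
    have h1 := ((h.hasFDerivAt_distGrad hτ).comp_hasDerivAt τ (hasDerivAt_line p v τ)).sub_const v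
    rw [map_sub, h.distHess_distGrad hτ, zero_sub, neg_neg]
    exact h1
  · exact Eventually.of_forall fun τ => ⟨by simpa using hasDerivAt_const τ (0 : E2), mem_univ _⟩
  · exact sub_eq_zero.2 hv

lemma infDist_ray_locally (h : ProxC2 S r) (hy : p + t • v ∈ tube S r)
    (hv : distGrad S (p + t • v) = v) (hd : infDist (p + t • v) S = t) :
    ∀ᶠ τ in 𝓝 t, infDist (p + τ • v) S = τ := by
  have hc : ContinuousAt (fun τ : ℝ => p + τ • v) t := (continuous_line p v).continuousAt
  refine ODE_solution_unique_of_eventually (v := fun _ _ => (1 : ℝ))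
    (s := fun _ => univ) (K := 0) (g := fun τ => τ) (t₀ := t) ?_ ?_ ?_ hd
  · exact Eventually.of_forall fun τ => (LipschitzWith.const _).lipschitzOnWith
  · filter_upwards [hc.eventually (isOpen_tube.mem_nhds hy), h.distGrad_ray_locally hy hv]
      with τ hτ hn
    refine ⟨?_, mem_univ _⟩
    have h1 := (h.hasFDerivAt_infDist hτ).comp_hasDerivAt τ (hasDerivAt_line p v τ)
    rw [innerSL_apply_apply, hn,
      inner_self_of_norm_one (by rw [← hn, h.norm_distGrad hτ])] at h1
    exact h1
  · exact Eventually.of_forall fun τ => ⟨hasDerivAt_id τ, mem_univ _⟩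

/-- Points of the tube project to `S` along a normal direction. -/
lemma isNormal_proj (h : ProxC2 S r) (hx : x ∈ tube S r) :
    IsNormal S r (proj S x) (distGrad S x) := by
  set p := proj S x with hp
  set v := distGrad S x with hv
  have hxp : p + infDist x S • v = x := proj_add_smul x
  let G : ℝ → Prop := fun t => infDist (p + t • v) S = t ∧ distGrad S (p + t • v) = v
  have hcl := continuous_line p v
  have hall : ∀ t ∈ Ioo 0 r, G t := by
    intro t ht
    have hG : G (infDist x S) := by
      refine ⟨by rw [hxp], by rw [hxp]⟩
    refine (isPreconnected_Ioo.induction₂ (fun a b => G a ↔ G b) ?_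
      (fun a b c _ _ _ h1 h2 => h1.trans h2) (fun a b _ _ h1 => h1.symm)
      (x := infDist x S) (y := t) hx ht).1 hG
    intro a ha
    apply nhdsWithin_le_nhds
    by_cases h1 : infDist (p + a • v) S = a
    · have hya : p + a • v ∈ tube S r := ⟨h1.symm ▸ ha.1, h1.symm ▸ ha.2⟩
      by_cases h2 : distGrad S (p + a • v) = v
      · filter_upwards [h.distGrad_ray_locally hya h2, h.infDist_ray_locally hya h2 h1]
          with b hb1 hb2
        exact ⟨fun _ => ⟨hb2, hb1⟩, fun _ => ⟨h1, h2⟩⟩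
      · have := (ContinuousAt.comp (f := fun τ : ℝ => p + τ • v)
          (h.continuousAt_distGrad hya) hcl.continuousAt).eventually_ne h2
        filter_upwards [this] with b hb
        exact ⟨fun hh => absurd hh.2 h2, fun hh => absurd hh.2 hb⟩
    · have hc : Continuous fun τ : ℝ => infDist (p + τ • v) S - τ :=
        ((continuous_infDist_pt S).comp hcl).sub continuous_id
      filter_upwards [hc.continuousAt.eventually_ne (sub_ne_zero.2 h1)] with b hb
      exact ⟨fun hh => absurd hh.1 h1, fun hh => absurd hh.1 (sub_ne_zero.1 hb)⟩
  refine ⟨h.norm_distGrad hx, fun t ht => ?_⟩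
  rcases ht.1.eq_or_lt with h0 | h0
  · rw [← h0, zero_smul, add_zero]
    exact infDist_zero_of_mem (h.proj_mem hx)
  · exact (hall t ⟨h0, ht.2⟩).1

end ProxC2

namespace IsNormal

lemma proj_eq (h : ProxC2 S r) (hn : IsNormal S r p v) (ht : t ∈ Ioo 0 r) :
    proj S (p + t • v) = p := by
  refine h.proj_eq (hn.mem_tube ht) (hn.mem h.closed h.nonempty h.pos) ?_
  rw [hn.2 t ⟨ht.1.le, ht.2⟩, dist_eq_norm, add_sub_cancel_left, norm_smul_of_norm_one hn.1 ht.1.le]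

lemma distGrad_eq (h : ProxC2 S r) (hn : IsNormal S r p v) (ht : t ∈ Ioo 0 r) :
    distGrad S (p + t • v) = v := by
  have h1 := ProxC2.proj_add_smul (S := S) (p + t • v)
  rw [hn.proj_eq h ht, hn.2 t ⟨ht.1.le, ht.2⟩] at h1
  exact smul_right_injective E2 ht.1.ne' (add_left_cancel h1)

/-- A point of `S` lies outside the ball of radius `r` touching `S` in a normal direction. -/
lemma inner_le (h : ProxC2 S r) (hn : IsNormal S r p v) (hq : q ∈ S) :
    2 * r * inner ℝ (q - p) v ≤ ‖q - p‖ ^ 2 := by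
  have key : ∀ t ∈ Ioo 0 r, 2 * t * inner ℝ (q - p) v ≤ ‖q - p‖ ^ 2 := by
    intro t ht
    have h1 : t ≤ ‖q - p - t • v‖ := by
      have := infDist_le_dist_of_mem (x := p + t • v) hq
      rwa [hn.2 t ⟨ht.1.le, ht.2⟩, dist_comm, dist_eq_norm, ← sub_sub] at this
    have h2 := norm_sub_smul_sq hn.1 (q - p) t
    nlinarith [ht.1]
  have hc : Tendsto (fun t : ℝ => 2 * t * inner ℝ (q - p) v) (𝓝[<] r)
      (𝓝 (2 * r * inner ℝ (q - p) v)) :=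
    (Continuous.tendsto (by fun_prop) r).mono_left nhdsWithin_le_nhds
  refine le_of_tendsto hc ?_
  filter_upwards [Ioo_mem_nhdsLT h.pos] with t ht using key t ht

end IsNormal

lemma isNormal_of_tendsto {ι : Type*} {l : Filter ι} [l.NeBot] {f g : ι → E2}
    (hf : Tendsto f l (𝓝 p)) (hg : Tendsto g l (𝓝 v)) (h : ∀ᶠ i in l, IsNormal S r (f i) (g i)) :
    IsNormal S r p v := by
  refine ⟨tendsto_nhds_unique hg.norm
    (tendsto_const_nhds.congr' (by filter_upwards [h] with i hi using hi.1.symm)), fun t ht => ?_⟩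
  have h1 : Tendsto (fun i => infDist (f i + t • g i) S) l (𝓝 (infDist (p + t • v) S)) :=
    ((continuous_infDist_pt S).tendsto _).comp (hf.add (hg.const_smul t))
  exact tendsto_nhds_unique h1
    (tendsto_const_nhds.congr' (by filter_upwards [h] with i hi using (hi.2 t ht).symm))

/-- A sequence of unit normals at points converging to `p` has a limit point normal at `p`. -/
lemma exists_subseq_isNormal {f g : ℕ → E2} (hf : Tendsto f atTop (𝓝 p))
    (h : ∀ᶠ n in atTop, IsNormal S r (f n) (g n)) :
    ∃ v, IsNormal S r p v ∧ ∃ φ : ℕ → ℕ, StrictMono φ ∧ Tendsto (g ∘ φ) atTop (𝓝 v) := by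
  obtain ⟨v, -, φ, hφ, hv⟩ := (isCompact_sphere (0 : E2) 1).tendsto_subseq' (x := g)
    (h.mono fun n hn => by simpa using hn.1).frequently
  exact ⟨v, isNormal_of_tendsto (hf.comp hφ.tendsto_atTop) hv
    (hφ.tendsto_atTop.eventually h), φ, hφ, hv⟩

namespace ProxC2

lemma exists_isNormal_of_mem (h : ProxC2 S r) (hint : interior S = ∅) (hp : p ∈ S) :
    ∃ v, IsNormal S r p v := by
  have hp' : p ∈ closure Sᶜ := by
    rw [closure_compl, hint, compl_empty]; trivial
  obtain ⟨f, hfS, hf⟩ := mem_closure_iff_seq_limit.1 hp'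
  have hd : Tendsto (fun n => infDist (f n) S) atTop (𝓝 0) := by
    have := ((continuous_infDist_pt S).tendsto p).comp hf
    rwa [infDist_zero_of_mem hp] at this
  have htube : ∀ᶠ n in atTop, f n ∈ tube S r := by
    filter_upwards [hd.eventually (gt_mem_nhds h.pos)] with n hn
    exact ⟨(h.closed.notMem_iff_infDist_pos h.nonempty).1 (hfS n), hn⟩
  have hproj : Tendsto (fun n => proj S (f n)) atTop (𝓝 p) := by
    rw [tendsto_iff_dist_tendsto_zero] at hf ⊢
    refine squeeze_zero' (Eventually.of_forall fun n => dist_nonneg) ?_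
      (by simpa using hd.add hf)
    filter_upwards [htube] with n hn
    rw [← h.dist_proj hn, dist_comm (f n) (proj S (f n))]
    exact dist_triangle _ _ _
  obtain ⟨v, hv, -⟩ := exists_subseq_isNormal (S := S) (r := r) hproj
    (htube.mono fun n hn => h.isNormal_proj hn)
  exact ⟨v, hv⟩

lemma exists_isNormal (h : ProxC2 S r) (hint : interior S = ∅) (hx : infDist x S < r) :
    ∃ q v, IsNormal S r q v ∧ x = q + infDist x S • v := by
  rcases (infDist_nonneg (x := x) (s := S)).eq_or_lt with h0 | h0
  · have hxS : x ∈ S := (h.closed.mem_iff_infDist_zero h.nonempty).2 h0.symm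
    obtain ⟨v, hv⟩ := h.exists_isNormal_of_mem hint hxS
    exact ⟨x, v, hv, by rw [← h0, zero_smul, add_zero]⟩
  · exact ⟨_, _, h.isNormal_proj ⟨h0, hx⟩, (proj_add_smul x).symm⟩

end ProxC2

namespace IsNormal

lemma hasDerivAt_proj (h : ProxC2 S r) (hn : IsNormal S r p v) (ht : t ∈ Ioo 0 r) :
    HasDerivAt (fun τ : ℝ => proj S (p + t • v + τ • rot v)) (scale S (p + t • v) • rot v) 0 := by
  have h1 := h.hasFDerivAt_proj (hn.mem_tube ht)
  rw [← add_zero (p + t • v), ← zero_smul ℝ (rot v)] at h1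
  have h2 := h1.comp_hasDerivAt (0 : ℝ) (hasDerivAt_line _ _ _)
  rw [zero_smul, add_zero, hn.distGrad_eq h ht] at h2
  simpa [hn.1] using! h2

lemma hasDerivAt_distGrad (h : ProxC2 S r) (hn : IsNormal S r p v) (ht : t ∈ Ioo 0 r) :
    HasDerivAt (fun τ : ℝ => distGrad S (p + t • v + τ • rot v))
      (curv S (p + t • v) • rot v) 0 := by
  have h1 := h.hasFDerivAt_distGrad (hn.mem_tube ht)
  rw [← add_zero (p + t • v), ← zero_smul ℝ (rot v)] at h1
  have h2 := h1.comp_hasDerivAt (0 : ℝ) (hasDerivAt_line _ _ _)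
  rw [zero_smul, add_zero, h.distHess_apply (hn.mem_tube ht), hn.distGrad_eq h ht] at h2
  simpa [hn.1] using! h2

lemma eventually_mem_tube (hn : IsNormal S r p v) (ht : t ∈ Ioo 0 r) :
    ∀ᶠ τ : ℝ in 𝓝 0, p + t • v + τ • rot v ∈ tube S r := by
  have hc : ContinuousAt (fun τ : ℝ => p + t • v + τ • rot v) 0 :=
    (continuous_line _ _).continuousAt
  refine hc.eventually (isOpen_tube.mem_nhds ?_)
  simpa using hn.mem_tube ht

lemma scale_nonneg (h : ProxC2 S r) (hn : IsNormal S r p v) (ht : t ∈ Ioo 0 r) :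
    0 ≤ scale S (p + t • v) := by
  have hpS := hn.mem h.closed h.nonempty h.pos
  have h1 : HasDerivAt (fun τ : ℝ => inner ℝ (rot v) (proj S (p + t • v + τ • rot v)))
      (scale S (p + t • v)) 0 := by
    have := (innerSL ℝ (rot v)).hasFDerivAt.comp_hasDerivAt (0 : ℝ) (hn.hasDerivAt_proj h ht)
    simpa [hn.1] using! this
  refine ge_of_tendsto h1.tendsto_slope_zero_right ?_
  filter_upwards [nhdsWithin_le_nhds (hn.eventually_mem_tube ht), self_mem_nhdsWithin]
    with τ hτ hτ0
  rw [zero_add, zero_smul, add_zero, hn.proj_eq h ht, smul_eq_mul, ← inner_sub_right]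
  refine mul_nonneg (inv_nonneg.2 (le_of_lt hτ0)) ?_
  set e := proj S (p + t • v + τ • rot v) - p with he
  have h2 : ‖t • v + τ • rot v - e‖ ≤ ‖t • v + τ • rot v‖ := by
    have := infDist_le_dist_of_mem (x := p + t • v + τ • rot v) hpS
    rw [← h.dist_proj hτ, dist_eq_norm, dist_eq_norm] at this
    rwa [show t • v + τ • rot v - e
        = p + t • v + τ • rot v - proj S (p + t • v + τ • rot v) by rw [he]; abel,
      show t • v + τ • rot v = p + t • v + τ • rot v - p by abel]
  have h3 : ‖t • v‖ ≤ ‖t • v - e‖ := by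
    have := infDist_le_dist_of_mem (x := p + t • v) (h.proj_mem hτ)
    rw [hn.2 t ⟨ht.1.le, ht.2⟩, dist_eq_norm] at this
    rwa [norm_smul_of_norm_one hn.1 ht.1.le, show t • v - e
        = p + t • v - proj S (p + t • v + τ • rot v) by rw [he]; abel]
  have h4 := pow_le_pow_left₀ (norm_nonneg _) h2 2
  have h5 := pow_le_pow_left₀ (norm_nonneg _) h3 2
  rw [norm_sub_sq_real] at h4 h5
  rw [inner_add_left, real_inner_smul_left (rot v)] at h4
  have hτ0' : 0 < τ := hτ0
  by_contra! hneg
  nlinarith [mul_pos_of_neg_of_neg hneg (neg_lt_zero.2 hτ0')]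

lemma eq_or_eq_neg (h : ProxC2 S r) (hn : IsNormal S r p v) (ht : t ∈ Ioo 0 r)
    (hs : scale S (p + t • v) ≠ 0) (hw : IsNormal S r p w) : w = v ∨ w = -v := by
  have h0 : proj S (p + t • v + (0 : ℝ) • rot v) = p := by
    rw [zero_smul, add_zero, hn.proj_eq h ht]
  have h1 := (hn.hasDerivAt_proj h ht).sub_const p
  have h2 := h1.inner ℝ (h1.const_sub ((2 * r) • w))
  have hmax : IsLocalMax (fun τ : ℝ => inner ℝ (proj S (p + t • v + τ • rot v) - p)
      ((2 * r) • w - (proj S (p + t • v + τ • rot v) - p))) 0 := by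
    filter_upwards [hn.eventually_mem_tube ht] with τ hτ
    rw [h0, sub_self, inner_zero_left, inner_sub_right, real_inner_smul_right,
      real_inner_self_eq_norm_sq]
    exact sub_nonpos.2 (hw.inner_le h (h.proj_mem hτ))
  have h3 := hmax.hasDerivAt_eq_zero h2
  rw [h0, sub_self, inner_zero_left, zero_add, sub_zero, real_inner_smul_left,
    real_inner_smul_right] at h3
  have h4 : inner ℝ (rot v) w = 0 := by
    have := h.pos
    simpa [hs, this.ne'] using h3
  have h5 := eq_inner_smul_add hn.1 w
  rw [h4, zero_smul, add_zero] at h5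
  have h6 : |(inner ℝ v w : ℝ)| = 1 := by
    have := hw.1
    rwa [h5, norm_smul, hn.1, mul_one, Real.norm_eq_abs] at this
  rcases eq_or_eq_neg_of_abs_eq h6 with h7 | h7
  · left; rw [h5, h7, one_smul]
  · right; rw [h5, h7, neg_smul, one_smul]

lemma neg_of_scale_ne_zero (h : ProxC2 S r) (hint : interior S = ∅) (hn : IsNormal S r p v)
    (ht : t ∈ Ioo 0 r) (hs : scale S (p + t • v) ≠ 0) : IsNormal S r p (-v) := by
  have hpS := hn.mem h.closed h.nonempty h.pos
  set ε : ℕ → ℝ := fun n => 1 / ((n : ℝ) + 1) with hε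
  have hε0 : ∀ n, 0 < ε n := fun n => by positivity
  have hεlim : Tendsto ε atTop (𝓝 0) := tendsto_one_div_add_atTop_nhds_zero_nat
  set y : ℕ → E2 := fun n => p - ε n • v with hy
  have hylim : Tendsto y atTop (𝓝 p) := by
    simpa using (hεlim.smul_const v).const_sub p
  set d : ℕ → ℝ := fun n => infDist (y n) S with hd
  have hdlim : Tendsto d atTop (𝓝 0) := by
    have := ((continuous_infDist_pt S).tendsto p).comp hylim
    rwa [infDist_zero_of_mem hpS] at this
  have hex : ∀ n, ∃ qv : E2 × E2, d n < r →
      IsNormal S r qv.1 qv.2 ∧ y n = qv.1 + d n • qv.2 := by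
    intro n
    by_cases hlt : d n < r
    · obtain ⟨q, v, h1, h2⟩ := h.exists_isNormal hint hlt
      exact ⟨(q, v), fun _ => ⟨h1, h2⟩⟩
    · exact ⟨0, fun hh => absurd hh hlt⟩
  choose qv hqv using hex
  have hlt : ∀ᶠ n in atTop, d n < r := hdlim.eventually (gt_mem_nhds h.pos)
  have hqlim : Tendsto (fun n => (qv n).1) atTop (𝓝 p) := by
    rw [tendsto_iff_dist_tendsto_zero] at hylim ⊢
    refine squeeze_zero' (Eventually.of_forall fun n => dist_nonneg) ?_
      (by simpa using hdlim.add hylim)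
    filter_upwards [hlt] with n hn1
    obtain ⟨h1, h2⟩ := hqv n hn1
    refine (dist_triangle _ (y n) _).trans (add_le_add_left ?_ _)
    rw [dist_comm, h2, dist_eq_norm, add_sub_cancel_left, norm_smul_of_norm_one h1.1 infDist_nonneg]
  obtain ⟨w, hw, φ, hφ, hwlim⟩ := exists_subseq_isNormal (g := fun n => (qv n).2) hqlim
    (hlt.mono fun n hn1 => (hqv n hn1).1)
  rcases hn.eq_or_eq_neg h ht hs hw with rfl | rfl
  · exfalso
    have h1 : ∀ᶠ n in atTop, 1 / 2 < (inner ℝ (qv (φ n)).2 w : ℝ) := by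
      have h2 : Tendsto (fun n => (inner ℝ (qv (φ n)).2 w : ℝ)) atTop (𝓝 (inner ℝ w w)) :=
        hwlim.inner tendsto_const_nhds
      rw [inner_self_of_norm_one hw.1] at h2
      exact h2.eventually (lt_mem_nhds (by norm_num))
    have h2 : ∀ᶠ n in atTop, d (φ n) + ε (φ n) < r := by
      have := (hdlim.add hεlim).comp hφ.tendsto_atTop
      rw [add_zero] at this
      exact this.eventually (gt_mem_nhds h.pos)
    obtain ⟨n, h3, h4, h5⟩ := (h1.and (h2.and (hφ.tendsto_atTop.eventually hlt))).exists
    obtain ⟨h6, h7⟩ := hqv (φ n) h5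
    set u := (qv (φ n)).2
    have hd0 : 0 ≤ d (φ n) := infDist_nonneg
    have he0 := hε0 (φ n)
    have h8 : p - (qv (φ n)).1 = d (φ n) • u + ε (φ n) • w := by
      have : p - ε (φ n) • w = (qv (φ n)).1 + d (φ n) • u := h7
      rw [← sub_eq_iff_eq_add'] at this
      rw [← this]; abel
    have h9 := h6.inner_le h hpS
    rw [h8, inner_add_left, real_inner_smul_left, real_inner_smul_left,
      inner_self_of_norm_one h6.1, real_inner_comm] at h9
    have h10 : ‖d (φ n) • u + ε (φ n) • w‖ ≤ d (φ n) + ε (φ n) := by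
      refine (norm_add_le _ _).trans_eq ?_
      rw [norm_smul_of_norm_one h6.1 hd0, norm_smul_of_norm_one hw.1 he0.le]
    have h11 := pow_le_pow_left₀ (norm_nonneg _) h10 2
    have h12 : ε (φ n) * (1 / 2) ≤ ε (φ n) * inner ℝ u w := mul_le_mul_of_nonneg_left h3.le he0.le
    nlinarith [mul_pos (add_pos_of_nonneg_of_pos hd0 he0) (sub_pos.2 h4), h.pos,
      mul_le_mul_of_nonneg_left h12 h.pos.le, mul_nonneg h.pos.le hd0]
  · exact hw

/-- Off the focal points, the scaling factor of the projection is bounded below. -/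
lemma le_scale (h : ProxC2 S r) (hint : interior S = ∅) (hn : IsNormal S r p v)
    (ht : t ∈ Ioo 0 r) (hs : scale S (p + t • v) ≠ 0) : r / (r + t) ≤ scale S (p + t • v) := by
  set ρ := scale S (p + t • v) with hρ
  set Q : ℝ → E2 := fun τ => proj S (p + t • v + τ • rot v) with hQ
  set N : ℝ → E2 := fun τ => distGrad S (p + t • v + τ • rot v) with hN
  have hQ0 : Q 0 = p := by simp only [hQ, zero_smul, add_zero, hn.proj_eq h ht]
  have hN0 : N 0 = v := by simp only [hN, zero_smul, add_zero, hn.distGrad_eq h ht]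
  have hQ1 := (hn.hasDerivAt_proj h ht).tendsto_slope_zero
  have hN1 := (hn.hasDerivAt_distGrad h ht).tendsto_slope_zero
  have hlim := hQ1.inner (hN1.sub (hQ1.const_smul r⁻¹)) (𝕜 := ℝ)
  have hx := hn.mem_tube ht
  have hsev : ∀ᶠ τ : ℝ in 𝓝 0, scale S (p + t • v + τ • rot v) ≠ 0 := by
    have hc : ContinuousAt (fun τ : ℝ => p + t • v + τ • rot v) 0 :=
      (continuous_line _ _).continuousAt
    refine (ContinuousAt.comp (f := fun τ : ℝ => p + t • v + τ • rot v) (g := scale S)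
      (h.continuousAt_scale (by simpa using hx)) hc).eventually_ne ?_
    simpa using hs
  have hle : inner ℝ (ρ • rot v) (curv S (p + t • v) • rot v - r⁻¹ • ρ • rot v) ≤ 0 := by
    refine le_of_tendsto hlim ?_
    filter_upwards [nhdsWithin_le_nhds (hn.eventually_mem_tube ht), nhdsWithin_le_nhds hsev]
      with τ hτ hsτ
    rw [zero_add]
    change inner ℝ (τ⁻¹ • (Q τ - Q 0)) (τ⁻¹ • (N τ - N 0) - r⁻¹ • τ⁻¹ • (Q τ - Q 0)) ≤ 0
    rw [hQ0, hN0]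
    have hnτ : IsNormal S r (Q τ) (N τ) := h.isNormal_proj hτ
    have hxτ := ProxC2.proj_add_smul (S := S) (p + t • v + τ • rot v)
    have hneg : IsNormal S r (Q τ) (-N τ) :=
      hnτ.neg_of_scale_ne_zero h hint (t := infDist (p + t • v + τ • rot v) S) hτ
        (by rw [hxτ]; exact hsτ)
    have hpS := hn.mem h.closed h.nonempty h.pos
    have h1 := (hn.neg_of_scale_ne_zero h hint ht hs).inner_le h (hnτ.mem h.closed h.nonempty h.pos)
    have h2 := hnτ.inner_le h hpS
    rw [← neg_sub (Q τ) p, inner_neg_left, norm_neg] at h2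
    have h1' := hn.inner_le h (hnτ.mem h.closed h.nonempty h.pos)
    have h2' := hneg.inner_le h hpS
    rw [← neg_sub (Q τ) p, inner_neg_left, norm_neg, inner_neg_right, neg_neg] at h2'
    rw [inner_neg_right] at h1
    rw [show τ⁻¹ • (N τ - v) - r⁻¹ • τ⁻¹ • (Q τ - p)
        = τ⁻¹ • (N τ - v - r⁻¹ • (Q τ - p)) by module, real_inner_smul_left,
      real_inner_smul_right, ← mul_assoc]
    refine mul_nonpos_of_nonneg_of_nonpos (mul_self_nonneg _) ?_
    rw [inner_sub_right, inner_sub_right, real_inner_smul_right, real_inner_self_eq_norm_sq,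
      sub_nonpos, ← div_eq_inv_mul, le_div_iff₀ h.pos]
    linarith
  have hρ0 : 0 < ρ := lt_of_le_of_ne (hn.scale_nonneg h ht) hs.symm
  rw [smul_smul, ← sub_smul, real_inner_smul_left, real_inner_smul_right, inner_rot_rot,
    inner_self_of_norm_one hn.1, mul_one] at hle
  have h1 : curv S (p + t • v) - r⁻¹ * ρ ≤ 0 := by
    by_contra! hh
    exact absurd hle (not_le.2 (mul_pos hρ0 hh))
  have h2 : ρ = 1 - t * curv S (p + t • v) := by rw [hρ, scale, hn.2 t ⟨ht.1.le, ht.2⟩]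
  have hr := h.pos
  have h3 : r * curv S (p + t • v) ≤ ρ := by
    rw [sub_nonpos, ← div_eq_inv_mul, le_div_iff₀ hr] at h1
    linarith
  rw [div_le_iff₀ (by linarith [ht.1])]
  nlinarith [mul_le_mul_of_nonneg_left h3 ht.1.le]

end IsNormal

namespace ProxC2

lemma eventually_scale_eq_zero (h : ProxC2 S r) (hint : interior S = ∅) (hx : x ∈ tube S r)
    (hs : scale S x = 0) : ∀ᶠ y in 𝓝 x, scale S y = 0 := by
  have h1 : ∀ᶠ y in 𝓝 x, scale S y < 1 / 2 :=
    (h.continuousAt_scale hx).eventually (gt_mem_nhds (by rw [hs]; norm_num))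
  filter_upwards [h1, isOpen_tube.mem_nhds hx] with y hy1 hy2
  by_contra hne
  have h2 := (h.isNormal_proj hy2).le_scale h hint hy2 (by rwa [proj_add_smul])
  rw [proj_add_smul] at h2
  have h3 : (1 : ℝ) / 2 ≤ r / (r + infDist y S) := by
    rw [div_le_div_iff₀ (by norm_num) (by linarith [h.pos, hy2.1])]
    linarith [hy2.2]
  linarith

lemma eventually_proj_eq (h : ProxC2 S r) (hint : interior S = ∅) (hx : x ∈ tube S r)
    (hs : scale S x = 0) : ∀ᶠ y in 𝓝 x, proj S y = proj S x := by
  obtain ⟨ε, hε, hball⟩ := Metric.eventually_nhds_iff_ball.1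
    ((h.eventually_scale_eq_zero hint hx hs).and (isOpen_tube.mem_nhds hx))
  filter_upwards [ball_mem_nhds x hε] with y hy
  refine (convex_ball x ε).is_const_of_fderivWithin_eq_zero (𝕜 := ℝ) (f := proj S) ?_ ?_ hy
    (mem_ball_self hε)
  · exact fun z hz =>
      (h.hasFDerivAt_proj (hball z hz).2).differentiableAt.differentiableWithinAt
  · intro z hz
    rw [((h.hasFDerivAt_proj (hball z hz).2).hasFDerivWithinAt).fderivWithin
      (isOpen_ball.uniqueDiffWithinAt hz), (hball z hz).1]
    ext1 u
    simp

lemma isNormal_of_infDist_eq (h : ProxC2 S r) (hp : p ∈ S) (hv : ‖v‖ = 1) (ht : t ∈ Ioo 0 r)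
    (hd : infDist (p + t • v) S = t) : IsNormal S r p v := by
  have hx : p + t • v ∈ tube S r := ⟨hd.symm ▸ ht.1, hd.symm ▸ ht.2⟩
  have hproj : proj S (p + t • v) = p := by
    refine h.proj_eq hx hp ?_
    rw [hd, dist_eq_norm, add_sub_cancel_left, norm_smul_of_norm_one hv ht.1.le]
  have h1 := h.isNormal_proj hx
  have h2 := proj_add_smul (S := S) (p + t • v)
  rw [hproj, hd] at h2
  rw [hproj] at h1
  rwa [smul_right_injective E2 ht.1.ne' (add_left_cancel h2)] at h1

/-- If the projection is critical at some point, then every direction is normal at its image. -/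
lemma isNormal_of_scale_eq_zero (h : ProxC2 S r) (hint : interior S = ∅) (hx : x ∈ tube S r)
    (hs : scale S x = 0) (hw : ‖w‖ = 1) : IsNormal S r (proj S x) w := by
  set p := proj S x with hp
  set t := infDist x S with htd
  have ht : t ∈ Ioo 0 r := hx
  have hpS : p ∈ S := h.proj_mem hx
  have hrank : 1 < Module.rank ℝ E2 := by
    rw [← Module.finrank_eq_rank, finrank_euclideanSpace_fin]; norm_num
  let G : E2 → Prop := fun u => infDist (p + t • u) S = t ∧ scale S (p + t • u) = 0
  have hcont : Continuous fun u : E2 => p + t • u := by fun_prop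
  have hxp : p + t • distGrad S x = x := proj_add_smul x
  have hG : G (distGrad S x) := ⟨by rw [hxp], by rw [hxp]; exact hs⟩
  have hGw : G w := by
    refine ((isPreconnected_sphere hrank (0 : E2) 1).induction₂ (fun a b => G a ↔ G b) ?_
      (fun a b c _ _ _ h1 h2 => h1.trans h2) (fun a b _ _ h1 => h1.symm)
      (by simpa using h.norm_distGrad hx) (by simpa using hw)).1 hG
    intro a ha
    rw [mem_sphere_zero_iff_norm] at ha
    by_cases h1 : infDist (p + t • a) S = t
    · have hxa : p + t • a ∈ tube S r := ⟨h1.symm ▸ ht.1, h1.symm ▸ ht.2⟩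
      by_cases h2 : scale S (p + t • a) = 0
      · have hpa : proj S (p + t • a) = p :=
          (h.isNormal_of_infDist_eq hpS ha ht h1).proj_eq h ht
        filter_upwards [nhdsWithin_le_nhds (hcont.continuousAt.eventually
            (h.eventually_scale_eq_zero hint hxa h2)),
          nhdsWithin_le_nhds (hcont.continuousAt.eventually (h.eventually_proj_eq hint hxa h2)),
          nhdsWithin_le_nhds (hcont.continuousAt.eventually (isOpen_tube.mem_nhds hxa)),
          self_mem_nhdsWithin] with b hb1 hb2 hb3 hb4
        rw [mem_sphere_zero_iff_norm] at hb4
        refine ⟨fun _ => ⟨?_, hb1⟩, fun _ => ⟨h1, h2⟩⟩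
        rw [← h.dist_proj hb3, hb2, hpa, dist_eq_norm, add_sub_cancel_left,
          norm_smul_of_norm_one hb4 ht.1.le]
      · have := (ContinuousAt.comp (f := fun u : E2 => p + t • u)
          (h.continuousAt_scale hxa) hcont.continuousAt).eventually_ne h2
        filter_upwards [nhdsWithin_le_nhds this] with b hb
        exact ⟨fun hh => absurd hh.2 h2, fun hh => absurd hh.2 hb⟩
    · have := ((continuous_infDist_pt S).comp hcont).continuousAt.eventually_ne h1
      filter_upwards [nhdsWithin_le_nhds this] with b hb
      exact ⟨fun hh => absurd hh.1 h1, fun hh => absurd hh.1 hb⟩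
  exact h.isNormal_of_infDist_eq hpS hw ht hGw.1

lemma scale_ne_zero (h : ProxC2 S r) (hint : interior S = ∅) (hconn : IsPreconnected S)
    (hns : ¬ ∃ p, S = {p}) (hx : x ∈ tube S r) : scale S x ≠ 0 := by
  intro hs
  set p := proj S x with hp
  have hpS : p ∈ S := h.proj_mem hx
  refine hns ⟨p, Subset.antisymm ?_ (singleton_subset_iff.2 hpS)⟩
  have hiso : ∀ q ∈ S, q ≠ p → r < dist q p := by
    intro q hq hqp
    have hpos : 0 < ‖q - p‖ := norm_pos_iff.2 (sub_ne_zero.2 hqp)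
    have h1 := (h.isNormal_of_scale_eq_zero hint hx hs (w := ‖q - p‖⁻¹ • (q - p))
      (by rw [norm_smul, norm_inv, norm_norm, inv_mul_cancel₀ hpos.ne'])).inner_le h hq
    rw [real_inner_smul_right, real_inner_self_eq_norm_sq, ← hp, pow_two, ← mul_assoc ‖q - p‖⁻¹,
      inv_mul_cancel₀ hpos.ne', one_mul] at h1
    rw [dist_eq_norm]
    have := le_of_mul_le_mul_right h1 hpos
    linarith [h.pos]
  have hsub : S ⊆ ball p r := by
    refine hconn.subset_left_of_subset_union isOpen_ball
      (isClosed_closedBall (x := p) (ε := r)).isOpen_compl ?_ ?_ ⟨p, hpS, mem_ball_self h.pos⟩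
    · exact disjoint_compl_right_iff_subset.2 ball_subset_closedBall
    · intro q hq
      by_cases hqp : q = p
      · left; rw [hqp]; exact mem_ball_self h.pos
      · right; simpa using hiso q hq hqp
  intro q hq
  by_contra hqp
  exact absurd (mem_ball.1 (hsub hq)) (not_lt.2 (hiso q hq hqp).le)

end ProxC2

/-- A bounded, globally Lipschitz autonomous vector field has global integral curves. -/
lemma exists_hasDerivAt_of_lipschitzWith_of_bounded {F : E2 → E2} {K L : NNReal}
    (hK : LipschitzWith K F) (hL : ∀ x, ‖F x‖ ≤ L) (x : E2) :
    ∃ c : ℝ → E2, c 0 = x ∧ ∀ t, HasDerivAt c (F (c t)) t := by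
  have hloc : ∀ n : ℕ, ∃ α : ℝ → E2, α 0 = x ∧
      ∀ t ∈ Ioo (-(n : ℝ)) n, HasDerivAt α (F (α t)) t := by
    intro n
    have hn : (0 : ℝ) ≤ n := n.cast_nonneg
    let t₀ : Icc (-(n : ℝ)) n := ⟨0, by constructor <;> linarith⟩
    have hPL : IsPicardLindelof (fun _ => F) t₀ x (L * n) 0 L K :=
      { lipschitzOnWith := fun _ _ => hK.lipschitzOnWith
        continuousOn := fun _ _ => continuousOn_const
        norm_le := fun _ _ y _ => hL y
        mul_max_le := by simp [t₀] }
    obtain ⟨α, h0, hα⟩ := hPL.exists_eq_forall_mem_Icc_hasDerivWithinAt₀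
    exact ⟨α, h0, fun t ht => (hα t (Ioo_subset_Icc_self ht)).hasDerivAt (Icc_mem_nhds ht.1 ht.2)⟩
  choose α h0 hα using hloc
  have huniq : ∀ m n : ℕ, m ≤ n → ∀ t ∈ Ioo (-(m : ℝ)) m, α m t = α n t := by
    intro m n hmn t ht
    have hmn' : (m : ℝ) ≤ n := Nat.cast_le.2 hmn
    refine ODE_solution_unique_of_mem_Ioo (v := fun _ => F) (s := fun _ => univ) (t₀ := 0)
      (fun _ _ => hK.lipschitzOnWith) ?_ (fun s hs => ⟨hα m s hs, mem_univ _⟩)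
      (fun s hs => ⟨hα n s ⟨by linarith [hs.1], by linarith [hs.2]⟩, mem_univ _⟩)
      (by rw [h0, h0]) ht
    constructor <;> linarith [ht.1, ht.2]
  let N : ℝ → ℕ := fun t => ⌊|t|⌋₊ + 1
  have hN : ∀ t, |t| < N t := fun t => by
    simpa [N] using Nat.lt_floor_add_one |t|
  refine ⟨fun t => α (N t) t, h0 _, fun t => ?_⟩
  have hev : (fun s => α (N s) s) =ᶠ[𝓝 t] α (N t) := by
    filter_upwards [continuous_abs.continuousAt.eventually (gt_mem_nhds (hN t))] with s hs
    rcases le_total (N s) (N t) with hle | hle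
    · exact huniq _ _ hle s (abs_lt.1 (hN s))
    · exact (huniq _ _ hle s (abs_lt.1 hs)).symm
  exact (hα (N t) t (abs_lt.1 (hN t))).congr_of_eventuallyEq hev

/-- `S` is a bounded connected proximally `C²` set with empty interior and at least two points. -/
structure ProxCurve (S : Set E2) (r : ℝ) : Prop extends ProxC2 S r where
  bounded : Bornology.IsBounded S
  conn : IsPreconnected S
  interior_eq : interior S = ∅
  not_singleton : ¬ ∃ p, S = {p}

/-- The level set of the distance function at half the radius. -/
def level (S : Set E2) (r : ℝ) : Set E2 := {x | infDist x S = r / 2}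

lemma half_mem (hr : 0 < r) : r / 2 ∈ Ioo 0 r := ⟨by linarith, by linarith⟩

lemma level_subset_tube (hr : 0 < r) (hx : x ∈ level S r) : x ∈ tube S r := by
  have : infDist x S = r / 2 := hx
  exact ⟨by rw [this]; linarith, by rw [this]; linarith⟩

lemma IsNormal.mem_level (hr : 0 < r) (hn : IsNormal S r p v) : p + (r / 2) • v ∈ level S r :=
  hn.2 _ ⟨(half_mem hr).1.le, (half_mem hr).2⟩

namespace ProxCurve

lemma half_lt_scale (h : ProxCurve S r) (hx : x ∈ tube S r) : 1 / 2 < scale S x := by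
  have h1 := (h.isNormal_proj hx).le_scale h.toProxC2 h.interior_eq hx
    (by rw [ProxC2.proj_add_smul]; exact h.scale_ne_zero h.interior_eq h.conn h.not_singleton hx)
  rw [ProxC2.proj_add_smul] at h1
  refine lt_of_lt_of_le ?_ h1
  rw [div_lt_div_iff₀ (by norm_num) (by linarith [h.pos, hx.1])]
  linarith [hx.2]

lemma isNormal_neg (h : ProxCurve S r) (hn : IsNormal S r p v) : IsNormal S r p (-v) :=
  have ht := half_mem h.pos
  hn.neg_of_scale_ne_zero h.toProxC2 h.interior_eq ht
    (h.scale_ne_zero h.interior_eq h.conn h.not_singleton (hn.mem_tube ht))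

lemma isNormal_eq_or_eq_neg (h : ProxCurve S r) (hn : IsNormal S r p v) (hw : IsNormal S r p w) :
    w = v ∨ w = -v :=
  have ht := half_mem h.pos
  hn.eq_or_eq_neg h.toProxC2 ht
    (h.scale_ne_zero h.interior_eq h.conn h.not_singleton (hn.mem_tube ht)) hw

lemma isBounded_sublevel (h : ProxCurve S r) (R : ℝ) : Bornology.IsBounded {x | infDist x S ≤ R} := by
  obtain ⟨M, hM⟩ := h.bounded.subset_closedBall 0
  refine (isBounded_closedBall (x := (0 : E2)) (r := R + M)).subset fun x hx => ?_
  obtain ⟨y, hy, hxy⟩ := h.closed.exists_infDist_eq_dist h.nonempty x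
  have h1 : dist x y ≤ R := hxy ▸ hx
  have h2 : dist y 0 ≤ M := hM hy
  exact (dist_triangle x y 0).trans (add_le_add h1 h2)

lemma isCompact_level (h : ProxCurve S r) : IsCompact (level S r) :=
  isCompact_of_isClosed_isBounded
    (isClosed_eq (continuous_infDist_pt S) continuous_const)
    ((h.isBounded_sublevel (r / 2)).subset fun _ hx => le_of_eq hx)

/-- A global vector field extending the rotated gradient of the distance function. -/
lemma exists_field (h : ProxCurve S r) : ∃ (F : E2 → E2) (K L : NNReal), ContDiff ℝ 1 F ∧
    LipschitzWith K F ∧ (∀ x, ‖F x‖ ≤ L) ∧ (∀ x, inner ℝ (distGrad S x) (F x) = 0) ∧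
    ∀ x ∈ level S r, F x = rot (distGrad S x) := by
  have hr := h.pos
  let b : ContDiffBump (r / 2) := ⟨r / 8, r / 4, by linarith, by linarith⟩
  let F : E2 → E2 := fun x => b (infDist x S) • rot (distGrad S x)
  have hzero : ∀ x, infDist x S ∉ Ioo (r / 4) (3 * r / 4) → F x = 0 := by
    intro x hx
    have : b (infDist x S) = 0 := by
      apply b.zero_of_le_dist
      change r / 4 ≤ dist (infDist x S) (r / 2)
      rw [Real.dist_eq]
      by_contra! hlt
      rw [abs_lt] at hlt
      exact hx ⟨by linarith, by linarith⟩
    simp only [F, this, zero_smul]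
  have hC : ContDiff ℝ 1 F := by
    rw [contDiff_iff_contDiffAt]
    intro x
    by_cases hx : infDist x S ∈ Icc (r / 4) (3 * r / 4)
    · have hxt : x ∈ tube S r := ⟨by linarith [hx.1], by linarith [hx.2]⟩
      have h1 : ContDiffAt ℝ 1 (fun y => b (infDist y S)) x :=
        b.contDiffAt.comp x ((h.contDiffAt hxt).of_le (by norm_num))
      exact h1.smul (rot.contDiff.contDiffAt.comp x (h.contDiffAt_distGrad hxt))
    · have : F =ᶠ[𝓝 x] fun _ => 0 := by
        filter_upwards [(continuous_infDist_pt S).continuousAt.eventually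
          (isClosed_Icc.isOpen_compl.mem_nhds hx)] with y hy
        exact hzero y fun hy' => hy (Ioo_subset_Icc_self hy')
      exact contDiffAt_const.congr_of_eventuallyEq this
  have hcpt : HasCompactSupport F := by
    refine HasCompactSupport.intro (isCompact_of_isClosed_isBounded
      (isClosed_le (continuous_infDist_pt S) continuous_const)
      (h.isBounded_sublevel (3 * r / 4))) fun x hx => hzero x fun hx' => hx hx'.2.le
  obtain ⟨K, hK⟩ := hC.lipschitzWith_of_hasCompactSupport hcpt one_ne_zero
  obtain ⟨L, hL⟩ := hC.continuous.bounded_above_of_compact_support hcpt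
  refine ⟨F, K, L.toNNReal, hC, hK, fun x => (hL x).trans (le_max_left _ _), fun x => ?_,
    fun x hx => ?_⟩
  · simp only [F, real_inner_smul_right, inner_self_rot, mul_zero]
  · have : b (infDist x S) = 1 := by
      apply b.one_of_mem_closedBall
      rw [show infDist x S = r / 2 from hx]
      exact mem_closedBall_self b.rIn_pos.le
    simp only [F, this, one_smul]

end ProxCurve

/-- `c` is a unit speed parametrization of a part of the level set of the distance function. -/
structure IsLevelCurve (S : Set E2) (r : ℝ) (c : ℝ → E2) : Prop where
  mem : ∀ t, c t ∈ level S r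
  hasDerivAt : ∀ t, HasDerivAt c (rot (distGrad S (c t))) t

namespace ProxCurve

lemma exists_isLevelCurve (h : ProxCurve S r) (hx : x ∈ level S r) :
    ∃ c, IsLevelCurve S r c ∧ c 0 = x := by
  obtain ⟨F, K, L, -, hK, hL, hF0, hF1⟩ := h.exists_field
  obtain ⟨c, hc0, hc⟩ := exists_hasDerivAt_of_lipschitzWith_of_bounded hK hL x
  have hcc : Continuous c := continuous_iff_continuousAt.2 fun t => (hc t).continuousAt
  have hd : Continuous fun t => infDist (c t) S := (continuous_infDist_pt S).comp hcc
  have hmem : ∀ t, c t ∈ level S r := by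
    intro t
    refine (isPreconnected_univ.induction₂ (fun a b => c a ∈ level S r ↔ c b ∈ level S r) ?_
      (fun a b c _ _ _ h1 h2 => h1.trans h2) (fun a b _ _ h1 => h1.symm)
      (mem_univ 0) (mem_univ t)).1 (hc0.symm ▸ hx)
    intro a _
    apply nhdsWithin_le_nhds
    by_cases ha : infDist (c a) S = r / 2
    · have hconst : ∀ᶠ b in 𝓝 a, infDist (c b) S = r / 2 := by
        refine ODE_solution_unique_of_eventually (v := fun _ _ => (0 : ℝ))
          (s := fun _ => univ) (K := 0) (g := fun _ => r / 2) (t₀ := a) ?_ ?_ ?_ ha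
        · exact Eventually.of_forall fun τ => (LipschitzWith.const _).lipschitzOnWith
        · filter_upwards [hcc.continuousAt.eventually
            (isOpen_tube.mem_nhds (level_subset_tube h.pos ha))] with b hb
          refine ⟨?_, mem_univ _⟩
          have h1 := (h.hasFDerivAt_infDist hb).comp_hasDerivAt b (hc b)
          rw [innerSL_apply_apply, hF0] at h1
          exact h1
        · exact Eventually.of_forall fun τ => ⟨hasDerivAt_const _ _, mem_univ _⟩
      filter_upwards [hconst] with b hb
      exact ⟨fun _ => hb, fun _ => ha⟩
    · filter_upwards [hd.continuousAt.eventually_ne ha] with b hb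
      exact ⟨fun hh => absurd hh ha, fun hh => absurd hh hb⟩
  exact ⟨c, ⟨hmem, fun t => hF1 _ (hmem t) ▸ hc t⟩, hc0⟩

end ProxCurve

namespace IsLevelCurve

variable {c c' : ℝ → E2}

lemma continuous (hc : IsLevelCurve S r c) : Continuous c :=
  continuous_iff_continuousAt.2 fun t => (hc.hasDerivAt t).continuousAt

lemma comp_add (hc : IsLevelCurve S r c) (a : ℝ) : IsLevelCurve S r fun t => c (t + a) where
  mem _ := hc.mem _
  hasDerivAt t := (hc.hasDerivAt (t + a)).comp_add_const t a

/-- Curves in the level set whose velocities are the same multiple of the rotated gradient and that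
meet at some time coincide. -/
lemma eq_of_hasDerivAt (h : ProxCurve S r) {f g : ℝ → E2} {β : ℝ → ℝ} {B : NNReal} {t₀ : ℝ}
    (hB : ∀ t, ‖β t‖₊ ≤ B) (hfm : ∀ t, f t ∈ level S r) (hgm : ∀ t, g t ∈ level S r)
    (hf : ∀ t, HasDerivAt f (β t • rot (distGrad S (f t))) t)
    (hg : ∀ t, HasDerivAt g (β t • rot (distGrad S (g t))) t) (h0 : f t₀ = g t₀) : f = g := by
  obtain ⟨F, K, L, -, hK, -, -, hF1⟩ := h.exists_field
  refine ODE_solution_unique_univ (v := fun t x => β t • F x) (s := fun _ => univ) (K := B * K)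
    (t₀ := t₀) (fun t => ?_) (fun t => ⟨?_, mem_univ _⟩) (fun t => ⟨?_, mem_univ _⟩) h0
  · refine LipschitzWith.lipschitzOnWith ?_
    exact ((lipschitzWith_smul (β t)).comp hK).weaken (mul_le_mul_left (hB t) K)
  · rw [hF1 _ (hfm t)]; exact hf t
  · rw [hF1 _ (hgm t)]; exact hg t

lemma eq_of_eq (h : ProxCurve S r) (hc : IsLevelCurve S r c) (hc' : IsLevelCurve S r c') {a b : ℝ}
    (hab : c a = c' b) (t : ℝ) : c (a + t) = c' (b + t) := by
  have := eq_of_hasDerivAt h (f := fun t => c (t + a)) (g := fun t => c' (t + b)) (β := fun _ => 1)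
    (B := 1) (t₀ := 0) (fun _ => by simp) (hc.comp_add a).mem (hc'.comp_add b).mem
    (fun t => by simpa using (hc.comp_add a).hasDerivAt t)
    (fun t => by simpa using (hc'.comp_add b).hasDerivAt t) (by simpa using hab)
  have := congrFun this t
  simpa [add_comm] using this

lemma range_eq (h : ProxCurve S r) (hc : IsLevelCurve S r c) (hc' : IsLevelCurve S r c') {a b : ℝ}
    (hab : c a = c' b) : range c = range c' := by
  ext y
  constructor
  · rintro ⟨t, rfl⟩
    exact ⟨b + (t - a), by rw [← eq_of_eq h hc hc' hab, add_sub_cancel]⟩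
  · rintro ⟨t, rfl⟩
    exact ⟨a + (t - b), by rw [eq_of_eq h hc hc' hab, add_sub_cancel]⟩

/-- A function that is strictly differentiable with gradient `v ≠ 0` separates nearby points whose
difference is parallel to `v`. -/
lemma eventually_eq_of_parallel {f : E2 → ℝ} (hvn : ‖v‖ = 1)
    (hf : HasStrictFDerivAt f (innerSL ℝ v) p) :
    ∃ W ∈ 𝓝 p, ∀ x ∈ W, ∀ y ∈ W, f x = f y →
      (inner ℝ (rot v) x : ℝ) = inner ℝ (rot v) y → x = y := by
  have hlo := hf.isLittleO.bound (c := 1 / 2) (by norm_num)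
  rw [nhds_prod_eq] at hlo
  obtain ⟨W, hW, hlo⟩ := mem_prod_self_iff.1 hlo
  refine ⟨W, hW, fun x hx y hy hxy hxy' => ?_⟩
  have h1 : ‖f x - f y - innerSL ℝ v (x - y)‖ ≤ 1 / 2 * ‖x - y‖ := hlo (mk_mem_prod hx hy)
  have h3 : x - y = (inner ℝ v (x - y) : ℝ) • v := by
    conv_lhs => rw [eq_inner_smul_add hvn (x - y)]
    rw [inner_sub_right (rot v), hxy', sub_self, zero_smul, add_zero]
  have h4 : ‖x - y‖ = ‖(inner ℝ v (x - y) : ℝ)‖ := by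
    conv_lhs => rw [h3]
    rw [norm_smul, hvn, mul_one]
  rw [hxy, sub_self, zero_sub, norm_neg, innerSL_apply_apply, ← h4] at h1
  have h5 : ‖x - y‖ = 0 := by linarith [norm_nonneg (x - y)]
  exact sub_eq_zero.1 (norm_eq_zero.1 h5)

lemma hasStrictDerivAt_inner (h : ProxCurve S r) (hc : IsLevelCurve S r c) :
    HasStrictDerivAt (fun t => (inner ℝ (rot (distGrad S (c 0))) (c t) : ℝ)) 1 0 := by
  have hx0 := level_subset_tube h.pos (hc.mem 0)
  have hvn : ‖distGrad S (c 0)‖ = 1 := h.norm_distGrad hx0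
  have h1 : ∀ t, HasDerivAt (fun t => (inner ℝ (rot (distGrad S (c 0))) (c t) : ℝ))
      (inner ℝ (rot (distGrad S (c 0))) (rot (distGrad S (c t)))) t := fun t =>
    ((innerSL ℝ (rot (distGrad S (c 0)))).hasFDerivAt.comp_hasDerivAt t (hc.hasDerivAt t))
  have h2 := hasStrictDerivAt_of_hasDerivAt_of_continuousAt (x := (0 : ℝ))
    (Eventually.of_forall h1) ?_
  · rwa [inner_rot_rot, inner_self_of_norm_one hvn] at h2
  · exact continuousAt_const.inner (rot.continuous.continuousAt.comp
      ((h.continuousAt_distGrad hx0).comp hc.continuous.continuousAt))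

/-- Near a point of a level curve, the level set consists of points of that curve only. -/
lemma eventually_mem_image (h : ProxCurve S r) (hc : IsLevelCurve S r c) {δ : ℝ} (hδ : 0 < δ) :
    ∀ᶠ x in 𝓝 (c 0), x ∈ level S r → ∃ t ∈ Ioo (-δ) δ, c t = x := by
  have hx0 := level_subset_tube h.pos (hc.mem 0)
  have hstrict : HasStrictFDerivAt (fun y => infDist y S) (innerSL ℝ (distGrad S (c 0))) (c 0) := by
    have := (h.contDiffAt hx0).hasStrictFDerivAt (by norm_num)
    rwa [(h.hasFDerivAt_infDist hx0).fderiv] at this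
  obtain ⟨W, hW, hWx⟩ := eventually_eq_of_parallel (h.norm_distGrad hx0) hstrict
  have hnhds : Ioo (-δ) δ ∩ c ⁻¹' W ∈ 𝓝 (0 : ℝ) :=
    inter_mem (Ioo_mem_nhds (by linarith) hδ) (hc.continuous.continuousAt hW)
  have himg := image_mem_map (m := fun t => (inner ℝ (rot (distGrad S (c 0))) (c t) : ℝ)) hnhds
  rw [(hasStrictDerivAt_inner h hc).map_nhds_eq one_ne_zero] at himg
  have hcX : Continuous fun x : E2 => (inner ℝ (rot (distGrad S (c 0))) x : ℝ) := by fun_prop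
  filter_upwards [hcX.continuousAt.eventually himg, hW] with x hx hxW hxl
  obtain ⟨t, ⟨ht, htW⟩, hte⟩ := hx
  exact ⟨t, ht, hWx _ htW _ hxW ((show infDist (c t) S = r / 2 from hc.mem t).trans
    (show infDist x S = r / 2 from hxl).symm) hte⟩

end IsLevelCurve

namespace ProxCurve

/-- Normals at nearby points of `S` can be chosen close to a given normal. -/
lemma eventually_exists_isNormal (h : ProxCurve S r) (hn : IsNormal S r p v) {P : E2 × E2 → Prop}
    (hP : ∀ᶠ z in 𝓝 (p, v), P z) : ∀ᶠ q in 𝓝 p, q ∈ S → ∃ w, IsNormal S r q w ∧ P (q, w) := by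
  by_contra hcon
  obtain ⟨f, hf, hfP⟩ := exists_seq_forall_of_frequently (not_eventually.1 hcon)
  push Not at hfP
  choose g hg using fun n => h.exists_isNormal_of_mem h.interior_eq (hfP n).1
  obtain ⟨u, hu, φ, hφ, hlim⟩ := exists_subseq_isNormal hf (Eventually.of_forall hg)
  have hfφ := hf.comp hφ.tendsto_atTop
  rcases h.isNormal_eq_or_eq_neg hn hu with rfl | rfl
  · obtain ⟨n, hn'⟩ := ((hfφ.prodMk_nhds hlim).eventually hP).exists
    exact (hfP (φ n)).2 _ (hg _) hn'
  · have hlim' : Tendsto (fun n => -(g ∘ φ) n) atTop (𝓝 v) := by simpa using hlim.neg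
    obtain ⟨n, hn'⟩ := ((hfφ.prodMk_nhds hlim').eventually hP).exists
    exact (hfP (φ n)).2 _ (h.isNormal_neg (hg _)) hn'

lemma distGrad_isNormal (h : ProxCurve S r) (hx : x ∈ level S r) :
    IsNormal S r (proj S x) (distGrad S x) :=
  h.isNormal_proj (level_subset_tube h.pos hx)

lemma proj_add_half_smul (hx : x ∈ level S r) : proj S x + (r / 2) • distGrad S x = x := by
  have := ProxC2.proj_add_smul (S := S) x
  rwa [show infDist x S = r / 2 from hx] at this

lemma mem_proj_range_iff (h : ProxCurve S r) {c : ℝ → E2} (hc : IsLevelCurve S r c)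
    (hn : IsNormal S r q w) :
    q ∈ proj S '' range c ↔ q + (r / 2) • w ∈ range c ∨ q + (r / 2) • (-w) ∈ range c := by
  constructor
  · rintro ⟨_, ⟨t, rfl⟩, rfl⟩
    have h1 := proj_add_half_smul (hc.mem t)
    rcases h.isNormal_eq_or_eq_neg hn (h.distGrad_isNormal (hc.mem t)) with h2 | h2
    · exact Or.inl ⟨t, by rw [← h2, h1]⟩
    · exact Or.inr ⟨t, by rw [← h2, h1]⟩
  · rintro (h1 | h1)
    · exact ⟨_, h1, hn.proj_eq h.toProxC2 (half_mem h.pos)⟩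
    · exact ⟨_, h1, (h.isNormal_neg hn).proj_eq h.toProxC2 (half_mem h.pos)⟩

lemma mem_range_iff (h : ProxCurve S r) {c c' : ℝ → E2} (hc : IsLevelCurve S r c)
    (hc' : IsLevelCurve S r c') (hx : x ∈ range c') : x ∈ range c ↔ range c = range c' := by
  refine ⟨fun hx' => ?_, fun he => he ▸ hx⟩
  obtain ⟨a, rfl⟩ := hx'
  obtain ⟨b, hb⟩ := hx
  exact hc.range_eq h hc' hb.symm

/-- A level curve projects onto `S`. -/
lemma proj_range_eq (h : ProxCurve S r) {c : ℝ → E2} (hc : IsLevelCurve S r c) :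
    proj S '' range c = S := by
  apply Subset.antisymm
  · rintro _ ⟨_, ⟨t, rfl⟩, rfl⟩
    exact h.proj_mem (level_subset_tube h.pos (hc.mem t))
  intro q hq
  have h0 := h.proj_mem (level_subset_tube h.pos (hc.mem 0))
  refine (h.conn.induction₂ (fun a b => a ∈ proj S '' range c ↔ b ∈ proj S '' range c) ?_
      (fun a b c _ _ _ h1 h2 => h1.trans h2) (fun a b _ _ h1 => h1.symm) h0 hq).1
    ⟨_, mem_range_self 0, rfl⟩
  intro p hp
  obtain ⟨v, hv⟩ := h.exists_isNormal_of_mem h.interior_eq hp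
  obtain ⟨c₁, hc₁, h₁⟩ := h.exists_isLevelCurve (hv.mem_level h.pos)
  obtain ⟨c₂, hc₂, h₂⟩ := h.exists_isLevelCurve ((h.isNormal_neg hv).mem_level h.pos)
  have key : ∀ q w, IsNormal S r q w → q + (r / 2) • w ∈ range c₁ →
      q + (r / 2) • (-w) ∈ range c₂ →
      (q ∈ proj S '' range c ↔ range c = range c₁ ∨ range c = range c₂) := by
    intro q w hw hq₁ hq₂
    rw [h.mem_proj_range_iff hc hw, h.mem_range_iff hc hc₁ hq₁, h.mem_range_iff hc hc₂ hq₂]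
  have e₁ := hc₁.eventually_mem_image h one_pos
  have e₂ := hc₂.eventually_mem_image h one_pos
  rw [h₁] at e₁
  rw [h₂] at e₂
  have t₁ : Tendsto (fun z : E2 × E2 => z.1 + (r / 2) • z.2) (𝓝 (p, v))
      (𝓝 (p + (r / 2) • v)) := by
    apply Continuous.tendsto (f := fun z : E2 × E2 => z.1 + (r / 2) • z.2)
    fun_prop
  have t₂ : Tendsto (fun z : E2 × E2 => z.1 + (r / 2) • (-z.2)) (𝓝 (p, v))
      (𝓝 (p + (r / 2) • (-v))) := by
    apply Continuous.tendsto (f := fun z : E2 × E2 => z.1 + (r / 2) • (-z.2))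
    fun_prop
  rw [eventually_nhdsWithin_iff]
  filter_upwards [h.eventually_exists_isNormal hv ((t₁.eventually e₁).and (t₂.eventually e₂))]
    with q hq hqS
  obtain ⟨w, hw, hq₁, hq₂⟩ := hq hqS
  obtain ⟨a, -, ha⟩ := hq₁ (hw.mem_level h.pos)
  obtain ⟨b, -, hb⟩ := hq₂ ((h.isNormal_neg hw).mem_level h.pos)
  rw [key p v hv ⟨0, h₁⟩ ⟨0, h₂⟩, key q w hw ⟨a, ha⟩ ⟨b, hb⟩]

end ProxCurve

namespace IsLevelCurve

variable {c : ℝ → E2}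

lemma norm_distGrad (h : ProxCurve S r) (hc : IsLevelCurve S r c) (t : ℝ) :
    ‖distGrad S (c t)‖ = 1 :=
  h.toProxC2.norm_distGrad (level_subset_tube h.pos (hc.mem t))

lemma exists_eq (h : ProxCurve S r) (hc : IsLevelCurve S r c) : ∃ T ≠ 0, c T = c 0 := by
  obtain ⟨x, hx, φ, hφ, hlim⟩ := h.isCompact_level.tendsto_subseq (x := fun n : ℕ => c n)
    fun n => hc.mem n
  obtain ⟨c', hc', rfl⟩ := h.exists_isLevelCurve hx
  have hev := hlim.eventually (hc'.eventually_mem_image h (δ := 1 / 4) (by norm_num))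
  obtain ⟨N, hN⟩ := eventually_atTop.1 hev
  obtain ⟨t, ht, hct⟩ := hN N le_rfl (hc.mem _)
  obtain ⟨u, hu, hcu⟩ := hN (N + 1) (Nat.le_succ N) (hc.mem _)
  have hlt : ((φ N : ℕ) : ℝ) + 1 ≤ φ (N + 1) := by exact_mod_cast hφ (Nat.lt_succ_self N)
  have h1 := eq_of_eq h hc' hc hct (u - t)
  rw [add_sub_cancel, hcu] at h1
  have h2 := eq_of_eq h hc hc h1 (-(φ N + (u - t)))
  refine ⟨(φ (N + 1) : ℝ) - (φ N + (u - t)), ?_, ?_⟩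
  · have := ht.1; have := hu.2; intro; linarith
  · rw [add_neg_cancel, ← sub_eq_add_neg] at h2
    exact h2

/-- Level curves are periodic. -/
lemma exists_period (h : ProxCurve S r) (hc : IsLevelCurve S r c) :
    ∃ T > 0, ∀ a b, c a = c b ↔ ∃ n : ℤ, a - b = n * T := by
  let G : AddSubgroup ℝ :=
    { carrier := {T | c T = c 0}
      zero_mem' := rfl
      add_mem' := fun {a b} ha hb => by
        have := eq_of_eq h hc hc (show c a = c 0 from ha) b
        rw [zero_add] at this
        exact this.trans hb
      neg_mem' := fun {a} ha => by
        have := eq_of_eq h hc hc (show c a = c 0 from ha) (-a)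
        rw [add_neg_cancel, zero_add] at this
        exact this.symm }
  have hG : ∀ a b, c a = c b ↔ a - b ∈ G := by
    intro a b
    constructor
    · intro hab
      have := eq_of_eq h hc hc hab (-b)
      rwa [add_neg_cancel, ← sub_eq_add_neg] at this
    · intro hab
      have := eq_of_eq h hc hc (show c (a - b) = c 0 from hab) b
      rwa [sub_add_cancel, zero_add] at this
  rcases G.dense_or_cyclic with hd | ⟨T, hT⟩
  · have hconst : c = fun _ => c 0 :=
      hc.continuous.ext_on hd continuous_const fun t ht => ht
    have h1 := hc.hasDerivAt 0
    rw [hconst] at h1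
    have h2 := h1.unique (hasDerivAt_const 0 (c 0))
    have h3 := hc.norm_distGrad h 0
    rw [← norm_rot, h2, norm_zero] at h3
    norm_num at h3
  · obtain ⟨T', hT', hcT'⟩ := hc.exists_eq h
    have hT'G : T' ∈ G := hcT'
    have hmem : ∀ a, a ∈ G ↔ ∃ n : ℤ, a = n * T := fun a => by
      rw [hT, AddSubgroup.mem_closure_singleton]
      simp only [zsmul_eq_mul, eq_comm]
    have hT0 : T ≠ 0 := by
      rintro rfl
      obtain ⟨n, hn⟩ := (hmem T').1 hT'G
      exact hT' (by simpa using hn)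
    refine ⟨|T|, abs_pos.2 hT0, fun a b => ?_⟩
    rw [hG, hmem]
    rcases abs_choice T with hT1 | hT1
    · rw [hT1]
    · rw [hT1]
      constructor
      · rintro ⟨n, hn⟩
        exact ⟨-n, by push_cast; linarith⟩
      · rintro ⟨n, hn⟩
        exact ⟨-n, by push_cast; linarith⟩

lemma hasDerivAt_proj (h : ProxCurve S r) (hc : IsLevelCurve S r c) (t : ℝ) :
    HasDerivAt (fun t => proj S (c t)) (scale S (c t) • rot (distGrad S (c t))) t := by
  have h1 := (h.hasFDerivAt_proj (level_subset_tube h.pos (hc.mem t))).comp_hasDerivAt t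
    (hc.hasDerivAt t)
  rw [ContinuousLinearMap.smulRight_apply, _root_.smul_apply, innerSL_apply_apply, inner_rot_rot,
    inner_self_of_norm_one (hc.norm_distGrad h t), smul_eq_mul, mul_one] at h1
  exact h1

lemma continuous_scale (h : ProxCurve S r) (hc : IsLevelCurve S r c) :
    Continuous fun t => scale S (c t) :=
  continuous_iff_continuousAt.2 fun t =>
    ContinuousAt.comp (f := c) (h.continuousAt_scale (level_subset_tube h.pos (hc.mem t)))
      hc.continuous.continuousAt

/-- The two points of the level set over a point of `S` do not lie on the same level curve. -/
lemma opposite_ne (h : ProxCurve S r) (hc : IsLevelCurve S r c) (a b : ℝ) :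
    proj S (c a) + (r / 2) • (-distGrad S (c a)) ≠ c b := by
  intro hab
  let f : ℝ → E2 := fun t => (2 : ℝ) • proj S (c t) - c t
  have hnt : ∀ t, IsNormal S r (proj S (c t)) (-distGrad S (c t)) := fun t =>
    h.isNormal_neg (h.distGrad_isNormal (hc.mem t))
  have hft : ∀ t, f t = proj S (c t) + (r / 2) • (-distGrad S (c t)) := fun t => by
    have := ProxCurve.proj_add_half_smul (hc.mem t)
    simp only [f]
    nth_rw 2 [← this]
    module
  have hfl : ∀ t, f t ∈ level S r := fun t => hft t ▸ (hnt t).mem_level h.pos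
  have hfg : ∀ t, distGrad S (f t) = -distGrad S (c t) := fun t => by
    rw [hft, (hnt t).distGrad_eq h.toProxC2 (half_mem h.pos)]
  let β : ℝ → ℝ := fun t => 1 - 2 * scale S (c t)
  have hβc : Continuous β := continuous_const.sub (continuous_const.mul (hc.continuous_scale h))
  have hβ0 : ∀ t, β t ≤ 0 := fun t => by
    have := h.half_lt_scale (level_subset_tube h.pos (hc.mem t))
    simp only [β]
    linarith
  have hf : ∀ t, HasDerivAt f (β t • rot (distGrad S (f t))) t := fun t => by
    have := ((hc.hasDerivAt_proj h t).const_smul (2 : ℝ)).sub (hc.hasDerivAt t)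
    refine this.congr_deriv ?_
    rw [hfg, map_neg]
    simp only [β]
    module
  let θ : ℝ → ℝ := fun t => b + ∫ u in a..t, β u
  have hθ : ∀ t, HasDerivAt θ (β t) t := fun t =>
    (intervalIntegral.integral_hasDerivAt_right (hβc.intervalIntegrable _ _)
      (hβc.stronglyMeasurableAtFilter _ _) hβc.continuousAt).const_add b
  have hθa : θ a = b := by simp [θ]
  obtain ⟨B, hB⟩ := h.isCompact_level.exists_bound_of_continuousOn (f := fun x => 1 - 2 * scale S x)
    fun x hx => (continuousAt_const.sub (continuousAt_const.mul
      (h.continuousAt_scale (level_subset_tube h.pos hx)))).continuousWithinAt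
  have heq : f = fun t => c (θ t) := by
    refine eq_of_hasDerivAt h (B := B.toNNReal) (β := β) (t₀ := a) (fun t => ?_) hfl
      (fun t => hc.mem _) hf (fun t => ?_) ?_
    · rw [← norm_toNNReal]
      exact Real.toNNReal_le_toNNReal (hB _ (hc.mem t))
    · exact (hc.hasDerivAt (θ t)).scomp t (hθ t)
    · rw [hθa, hft, hab]
  have hanti : Antitone θ := antitone_of_hasDerivAt_nonpos hθ hβ0
  have hθc : Continuous θ := continuous_iff_continuousAt.2 fun t => (hθ t).continuousAt
  obtain ⟨t, ht⟩ : ∃ t, t - θ t = 0 := by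
    have := mem_range_of_exists_le_of_exists_ge (c := (0 : ℝ)) (continuous_id.sub hθc)
      ⟨min a b, by
        have := hanti (min_le_left a b)
        simp only [Pi.sub_apply, id]
        linarith [min_le_right a b]⟩
      ⟨max a b, by
        have := hanti (le_max_left a b)
        simp only [Pi.sub_apply, id]
        linarith [le_max_right a b]⟩
    exact this
  have h1 : distGrad S (c t) = -distGrad S (c t) := by
    have := hfg t
    rwa [congrFun heq t, ← sub_eq_zero.1 ht] at this
  have h2 := hc.norm_distGrad h t
  have h3 := inner_self_of_norm_one h2
  nth_rw 1 [h1] at h3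
  rw [inner_neg_left, inner_self_of_norm_one h2] at h3
  norm_num at h3

/-- Level curves project injectively to `S`. -/
lemma eq_of_proj_eq (h : ProxCurve S r) (hc : IsLevelCurve S r c) {a b : ℝ}
    (hab : proj S (c a) = proj S (c b)) : c a = c b := by
  have h1 := ProxCurve.proj_add_half_smul (hc.mem a)
  have h2 := ProxCurve.proj_add_half_smul (hc.mem b)
  rcases h.isNormal_eq_or_eq_neg (h.distGrad_isNormal (hc.mem a))
    (hab ▸ h.distGrad_isNormal (hc.mem b)) with h3 | h3
  · rw [← h1, ← h2, hab, h3]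
  · refine absurd ?_ (hc.opposite_ne h a b)
    rw [← h3, hab, h2]

end IsLevelCurve

namespace IsLevelCurve

variable {c : ℝ → E2}

/-- The arc length of the projection of a level curve to `S`. -/
lemma exists_arclength (h : ProxCurve S r) (hc : IsLevelCurve S r c) :
    ∃ σ : ℝ ≃ₜ ℝ, StrictMono σ ∧ σ 0 = 0 ∧ ∀ t, HasDerivAt σ (scale S (c t)) t := by
  have hρc := hc.continuous_scale h
  have hρ : ∀ t, 1 / 2 < scale S (c t) := fun t =>
    h.half_lt_scale (level_subset_tube h.pos (hc.mem t))
  let σ : ℝ → ℝ := fun t => ∫ u in (0 : ℝ)..t, scale S (c u)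
  have hσ : ∀ t, HasDerivAt σ (scale S (c t)) t := fun t =>
    intervalIntegral.integral_hasDerivAt_right (hρc.intervalIntegrable _ _)
      (hρc.stronglyMeasurableAtFilter _ _) hρc.continuousAt
  have hσ0 : σ 0 = 0 := intervalIntegral.integral_same
  have hσc : Continuous σ := continuous_iff_continuousAt.2 fun t => (hσ t).continuousAt
  have hmono : StrictMono σ := strictMono_of_hasDerivAt_pos hσ fun t => by linarith [hρ t]
  have hgrow : Monotone fun t => σ t - 1 / 2 * t := by
    refine monotone_of_hasDerivAt_nonneg
      (fun t => (hσ t).sub ((hasDerivAt_id t).const_mul (1 / 2))) fun t => ?_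
    simp only [Pi.zero_apply]
    linarith [hρ t]
  have htop : Tendsto σ atTop atTop := by
    refine tendsto_atTop_mono' atTop ?_ (tendsto_id.const_mul_atTop (by norm_num : (0 : ℝ) < 1 / 2))
    filter_upwards [eventually_ge_atTop 0] with t ht
    have := hgrow ht
    simp only [hσ0, id] at this ⊢
    linarith
  have hbot : Tendsto σ atBot atBot := by
    refine tendsto_atBot_mono' atBot ?_ (tendsto_id.const_mul_atBot (by norm_num : (0 : ℝ) < 1 / 2))
    filter_upwards [eventually_le_atBot 0] with t ht
    have := hgrow ht
    simp only [hσ0, id] at this ⊢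
    linarith
  exact ⟨(hmono.orderIsoOfSurjective σ (hσc.surjective htop hbot)).toHomeomorph, hmono, hσ0, hσ⟩

lemma contDiff (h : ProxCurve S r) (hc : IsLevelCurve S r c) : ContDiff ℝ 1 c := by
  rw [contDiff_one_iff_deriv]
  refine ⟨fun t => (hc.hasDerivAt t).differentiableAt, ?_⟩
  rw [funext fun t => (hc.hasDerivAt t).deriv]
  exact continuous_iff_continuousAt.2 fun t => rot.continuous.continuousAt.comp
    (ContinuousAt.comp (f := c) (h.continuousAt_distGrad (level_subset_tube h.pos (hc.mem t)))
      hc.continuous.continuousAt)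

variable {σ : ℝ ≃ₜ ℝ}

lemma hasDerivAt_symm (h : ProxCurve S r) (hc : IsLevelCurve S r c)
    (hσ : ∀ t, HasDerivAt σ (scale S (c t)) t) (t : ℝ) :
    HasDerivAt σ.symm (scale S (c (σ.symm t)))⁻¹ t := by
  have hρ := h.half_lt_scale (level_subset_tube h.pos (hc.mem (σ.symm t)))
  exact (hσ (σ.symm t)).of_local_left_inverse σ.symm.continuous.continuousAt (by linarith)
    (Eventually.of_forall σ.apply_symm_apply)

lemma hasDerivAt_proj_symm (h : ProxCurve S r) (hc : IsLevelCurve S r c)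
    (hσ : ∀ t, HasDerivAt σ (scale S (c t)) t) (t : ℝ) :
    HasDerivAt (fun t => proj S (c (σ.symm t))) (rot (distGrad S (c (σ.symm t)))) t := by
  have hρ := h.half_lt_scale (level_subset_tube h.pos (hc.mem (σ.symm t)))
  have := (hc.hasDerivAt_proj h (σ.symm t)).scomp t (hc.hasDerivAt_symm h hσ t)
  rwa [smul_smul, inv_mul_cancel₀ (by linarith), one_smul] at this

lemma contDiff_proj_symm (h : ProxCurve S r) (hc : IsLevelCurve S r c)
    (hσ : ∀ t, HasDerivAt σ (scale S (c t)) t) :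
    ContDiff ℝ 2 fun t => proj S (c (σ.symm t)) := by
  have hθ : ContDiff ℝ 1 σ.symm := by
    rw [contDiff_one_iff_deriv]
    refine ⟨fun t => (hc.hasDerivAt_symm h hσ t).differentiableAt, ?_⟩
    rw [funext fun t => (hc.hasDerivAt_symm h hσ t).deriv]
    refine ((hc.continuous_scale h).comp σ.symm.continuous).inv₀ fun t => ?_
    have hρ := h.half_lt_scale (level_subset_tube h.pos (hc.mem (σ.symm t)))
    simp only [Function.comp_apply]
    linarith
  rw [show (2 : WithTop ℕ∞) = 1 + 1 by norm_num, contDiff_succ_iff_deriv]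
  refine ⟨fun t => (hc.hasDerivAt_proj_symm h hσ t).differentiableAt, by simp, ?_⟩
  rw [funext fun t => (hc.hasDerivAt_proj_symm h hσ t).deriv]
  refine rot.contDiff.comp (contDiff_iff_contDiffAt.2 fun t => ?_)
  exact ContDiffAt.comp t (f := fun t => c (σ.symm t))
    (h.contDiffAt_distGrad (level_subset_tube h.pos (hc.mem _)))
    ((hc.contDiff h).comp hθ).contDiffAt

/-- The arc length parametrization of `S` is periodic, injective on a period and surjective. -/
lemma exists_period_proj_symm (h : ProxCurve S r) (hc : IsLevelCurve S r c)
    (hmono : StrictMono σ) (hσ0 : σ 0 = 0) (hσ : ∀ t, HasDerivAt σ (scale S (c t)) t) :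
    ∃ L > 0, Function.Periodic (fun t => proj S (c (σ.symm t))) L ∧
      InjOn (fun t => proj S (c (σ.symm t))) (Ico 0 L) := by
  obtain ⟨T, hT, hcT⟩ := hc.exists_period h
  have hper : ∀ t, c (t + T) = c t := fun t => (hcT _ _).2 ⟨1, by simp⟩
  have hσT : ∀ t, σ (t + T) = σ t + σ T := by
    intro t
    have h1 : ∀ t, HasDerivAt (fun t => σ (t + T) - σ t) 0 t := fun t => by
      have := ((hσ (t + T)).comp_add_const t T).sub (hσ t)
      rwa [hper, sub_self] at this
    have h2 := is_const_of_deriv_eq_zero (fun t => (h1 t).differentiableAt)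
      (fun t => (h1 t).deriv) t 0
    simp only [zero_add, hσ0] at h2
    linarith
  refine ⟨σ T, by simpa [hσ0] using hmono hT, fun t => ?_, fun a ha b hb hab => ?_⟩
  · have : σ.symm (t + σ T) = σ.symm t + T := by
      rw [σ.symm_apply_eq, hσT, σ.apply_symm_apply]
    simp only [this, hper]
  · obtain ⟨n, hn⟩ := (hcT _ _).1 (hc.eq_of_proj_eq h hab)
    have key : ∀ a ∈ Ico 0 (σ T), σ.symm a ∈ Ico 0 T := fun a ha => by
      rw [mem_Ico, ← hmono.le_iff_le, ← hmono.lt_iff_lt, σ.apply_symm_apply, hσ0]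
      exact ha
    have h1 := key a ha
    have h2 := key b hb
    have hn1 : (n : ℝ) < 1 := by
      by_contra! hle
      nlinarith [h1.1, h1.2, h2.1, h2.2]
    have hn2 : (-1 : ℝ) < n := by
      by_contra! hle
      nlinarith [h1.1, h1.2, h2.1, h2.2]
    have hn0 : n = 0 := by
      have h3 : n < 1 := by exact_mod_cast hn1
      have h4 : -1 < n := by exact_mod_cast hn2
      omega
    rw [hn0, Int.cast_zero, zero_mul] at hn
    exact σ.symm.injective (sub_eq_zero.1 hn)

lemma range_proj_symm (h : ProxCurve S r) (hc : IsLevelCurve S r c) :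
    range (fun t => proj S (c (σ.symm t))) = S := by
  rw [show (fun t => proj S (c (σ.symm t))) = (fun t => proj S (c t)) ∘ σ.symm from rfl,
    σ.symm.surjective.range_comp, range_comp' (proj S) c, h.proj_range_eq hc]

/-- Near a point of `S`, the points of `S` have nearby arc length parameters. -/
lemma eventually_proj_symm_eq (h : ProxCurve S r) (hc : IsLevelCurve S r c)
    (hσ0 : σ 0 = 0) {δ : ℝ} (hδ : 0 < δ) :
    ∀ᶠ q in 𝓝 (proj S (c 0)), q ∈ S → ∃ t ∈ Ioo (-δ) δ, proj S (c (σ.symm t)) = q := by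
  obtain ⟨ε, hε, hσε⟩ := Metric.continuousAt_iff.1 σ.continuous.continuousAt δ hδ
  have hev := hc.eventually_mem_image h hε
  rw [← ProxCurve.proj_add_half_smul (hc.mem 0)] at hev
  have ht : Tendsto (fun z : E2 × E2 => z.1 + (r / 2) • z.2)
      (𝓝 (proj S (c 0), distGrad S (c 0))) (𝓝 (proj S (c 0) + (r / 2) • distGrad S (c 0))) := by
    apply Continuous.tendsto (f := fun z : E2 × E2 => z.1 + (r / 2) • z.2)
    fun_prop
  filter_upwards [h.eventually_exists_isNormal (h.distGrad_isNormal (hc.mem 0))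
    (ht.eventually hev)] with q hq hqS
  obtain ⟨w, hw, hwc⟩ := hq hqS
  obtain ⟨τ, hτ, hcτ⟩ := hwc (hw.mem_level h.pos)
  refine ⟨σ τ, ?_, ?_⟩
  · have := hσε (x := τ) (by rw [Real.dist_eq, sub_zero]; exact abs_lt.2 hτ)
    rw [hσ0, Real.dist_eq, sub_zero] at this
    exact abs_lt.1 this
  · rw [σ.symm_apply_apply, hcτ, hw.proj_eq h.toProxC2 (half_mem h.pos)]

end IsLevelCurve

/-! ### Curves as graphs -/

lemma exists_contDiff_eventuallyEq {f : ℝ → ℝ} {x : ℝ} {n : ℕ} (hf : ContDiffAt ℝ n f x) :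
    ∃ g : ℝ → ℝ, ContDiff ℝ n g ∧ g =ᶠ[𝓝 x] f := by
  obtain ⟨ε, hε, hfε⟩ := Metric.eventually_nhds_iff.1 (hf.eventually (by simp))
  let b : ContDiffBump x := ⟨ε / 4, ε / 2, by linarith, by linarith⟩
  refine ⟨fun y => b y * f y, contDiff_iff_contDiffAt.2 fun y => ?_, ?_⟩
  · by_cases hy : dist y x < ε
    · exact b.contDiffAt.mul (hfε hy)
    · have : (fun y => b y * f y) =ᶠ[𝓝 y] fun _ => 0 := by
        have hy' : ε / 2 < dist y x := by linarith
        filter_upwards [(continuous_id.dist continuous_const).continuousAt.eventually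
          (lt_mem_nhds hy')] with z hz
        rw [b.zero_of_le_dist (show ε / 2 ≤ dist z x from hz.le), zero_mul]
      exact contDiffAt_const.congr_of_eventuallyEq this
  · filter_upwards [b.eventuallyEq_one] with y hy
    rw [hy, Pi.one_apply, one_mul]

/-- Coordinates centred at `p` in the orthonormal frame `u, rot u`. -/
lemma exists_coordinates (p : E2) {u : E2} (hu : ‖u‖ = 1) :
    ∃ e : E2 ≃ᵃⁱ[ℝ] E2, ∀ q, e q = pt (inner ℝ u (q - p)) (inner ℝ (rot u) (q - p)) := by
  let L : E2 →ₗᵢ[ℝ] E2 :=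
    { toFun := fun q => pt (inner ℝ u q) (inner ℝ (rot u) q)
      map_add' := fun x y => by
        ext i; fin_cases i <;> simp [inner_add_right]
      map_smul' := fun c x => by
        ext i; fin_cases i <;> simp [real_inner_smul_right]
      norm_map' := fun q => by
        have h1 := real_inner_self_eq_norm_sq (pt (inner ℝ u q) (inner ℝ (rot u) q))
        have h2 := real_inner_self_eq_norm_sq q
        have h3 : (inner ℝ q q : ℝ)
            = inner ℝ u q * inner ℝ u q + inner ℝ (rot u) q * inner ℝ (rot u) q := by
          nth_rw 2 [eq_inner_smul_add hu q]
          rw [inner_add_right, real_inner_smul_right, real_inner_smul_right,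
            real_inner_comm u q, real_inner_comm (rot u) q]
        rw [inner_eq_coord, pt_apply_zero, pt_apply_one, ← h3, h2] at h1
        exact ((sq_eq_sq₀ (norm_nonneg _) (norm_nonneg _)).1 h1).symm }
  refine ⟨(AffineIsometryEquiv.constVAdd ℝ E2 (-p)).trans
    (L.toLinearIsometryEquiv rfl).toAffineIsometryEquiv, fun q => ?_⟩
  change L (-p +ᵥ q) = _
  rw [vadd_eq_add, neg_add_eq_sub]
  rfl

/-- A set which is locally parametrized by a regular `C²` curve is locally a `C²` graph. -/
lemma isC2GraphAt_of_curve {γ : ℝ → E2} {u : E2} (hγ : ContDiff ℝ 2 γ) (hu : ‖u‖ = 1)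
    (hd : HasDerivAt γ u 0) (hmem : ∀ t, γ t ∈ S)
    (hloc : ∀ δ > 0, ∀ᶠ q in 𝓝 (γ 0), q ∈ S → ∃ t ∈ Ioo (-δ) δ, γ t = q) :
    IsC2GraphAt S (γ 0) := by
  obtain ⟨e, he⟩ := exists_coordinates (γ 0) hu
  let X : ℝ → ℝ := fun t => inner ℝ u (γ t - γ 0)
  let Y : ℝ → ℝ := fun t => inner ℝ (rot u) (γ t - γ 0)
  have hX : ContDiff ℝ 2 X := contDiff_const.inner ℝ (hγ.sub contDiff_const)
  have hY : ContDiff ℝ 2 Y := contDiff_const.inner ℝ (hγ.sub contDiff_const)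
  have hX0 : X 0 = 0 := by simp [X]
  have hXd : HasDerivAt X 1 0 := by
    have := (innerSL ℝ u).hasFDerivAt.comp_hasDerivAt (0 : ℝ) (hd.sub_const (γ 0))
    rwa [innerSL_apply_apply, inner_self_of_norm_one hu] at this
  let A : ℝ ≃L[ℝ] ℝ := ContinuousLinearEquiv.refl ℝ ℝ
  have hXA : HasFDerivAt X (A : ℝ →L[ℝ] ℝ) 0 := by
    refine hXd.hasFDerivAt.congr_fderiv ?_
    ext
    simp [A]
  let φ := hX.contDiffAt.toOpenPartialHomeomorph X hXA (by norm_num)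
  have hφX : ∀ t, φ t = X t := fun t => rfl
  have h0s : (0 : ℝ) ∈ φ.source :=
    hX.contDiffAt.mem_toOpenPartialHomeomorph_source hXA (by norm_num)
  have h0t : (0 : ℝ) ∈ φ.target := by
    have := φ.map_source h0s
    rwa [hφX, hX0] at this
  have hφ0 : φ.symm 0 = 0 := by
    have := φ.left_inv h0s
    rwa [hφX, hX0] at this
  have hφs : ContDiffAt ℝ 2 φ.symm 0 := by
    refine φ.contDiffAt_symm (f₀' := A) h0t ?_ ?_
    · rw [hφ0]; exact hXA
    · rw [hφ0]; exact hX.contDiffAt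
  obtain ⟨g, hg, hgY⟩ := exists_contDiff_eventuallyEq (n := 2)
    (hY.contDiffAt.comp (0 : ℝ) hφs)
  obtain ⟨δ, hδ, hδs⟩ := Metric.mem_nhds_iff.1 (φ.open_source.mem_nhds h0s)
  rw [Real.ball_zero_eq_Ioo] at hδs
  obtain ⟨V, hVS, hV, h0V⟩ := _root_.mem_nhds_iff.1 (hloc δ hδ)
  have hγφ : ContinuousAt (fun x => γ (φ.symm x)) 0 :=
    ContinuousAt.comp (f := φ.symm) hγ.continuous.continuousAt hφs.continuousAt
  have hVev : ∀ᶠ x in 𝓝 (0 : ℝ), γ (φ.symm x) ∈ V :=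
    hγφ.eventually (hV.mem_nhds (by simpa only [hφ0] using h0V))
  have htev : ∀ᶠ x in 𝓝 (0 : ℝ), x ∈ φ.target := φ.open_target.mem_nhds h0t
  obtain ⟨η, hη, hηx⟩ := Metric.eventually_nhds_iff.1 (htev.and (hgY.and hVev))
  have hηx' : ∀ x ∈ Ioo (-η) η, x ∈ φ.target ∧ g x = Y (φ.symm x) ∧ γ (φ.symm x) ∈ V :=
    fun x hx => hηx (by rw [Real.dist_eq, sub_zero]; exact abs_lt.2 hx)
  have hcont : Continuous fun q : E2 => (inner ℝ u (q - γ 0) : ℝ) := by fun_prop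
  refine ⟨e, V ∩ (fun q : E2 => (inner ℝ u (q - γ 0) : ℝ)) ⁻¹' Ioo (-η) η, g, -η, η,
    hV.inter (isOpen_Ioo.preimage hcont), ⟨h0V, ?_⟩, by linarith, hg, Subset.antisymm ?_ ?_⟩
  · rw [mem_preimage, sub_self, inner_zero_right]
    exact ⟨by linarith, hη⟩
  · rintro _ ⟨q, ⟨hqS, hqV, hqη⟩, rfl⟩
    obtain ⟨t, ht, rfl⟩ := hVS hqV hqS
    obtain ⟨-, h1, -⟩ := hηx' _ hqη
    have h2 : φ.symm (X t) = t := φ.left_inv (hδs ht)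
    refine ⟨X t, hqη, ?_⟩
    simp only [he]
    rw [show g (X t) = Y t from h1.trans (congrArg Y h2)]
  · rintro _ ⟨x, hx, rfl⟩
    obtain ⟨h1, h2, h3⟩ := hηx' x hx
    have h4 : X (φ.symm x) = x := φ.right_inv h1
    refine ⟨γ (φ.symm x), ⟨hmem _, h3, ?_⟩, ?_⟩
    · rw [mem_preimage]
      change X (φ.symm x) ∈ Ioo (-η) η
      rwa [h4]
    · simp only [he]
      rw [h2]
      exact congrArg (fun z => pt z _) h4

lemma ProxCurve.isC2GraphAt (h : ProxCurve S r) (hp : p ∈ S) : IsC2GraphAt S p := by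
  obtain ⟨v, hv⟩ := h.exists_isNormal_of_mem h.interior_eq hp
  obtain ⟨c, hc, hc0⟩ := h.exists_isLevelCurve (hv.mem_level h.pos)
  obtain ⟨σ, -, hσ0, hσ⟩ := hc.exists_arclength h
  have h0 : σ.symm 0 = 0 := by rw [σ.symm_apply_eq, hσ0]
  have hpc : proj S (c 0) = p := by rw [hc0, hv.proj_eq h.toProxC2 (half_mem h.pos)]
  have := isC2GraphAt_of_curve (S := S) (hc.contDiff_proj_symm h hσ)
    ((norm_rot _).trans (hc.norm_distGrad h _)) (hc.hasDerivAt_proj_symm h hσ 0)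
    (fun t => h.proj_mem (level_subset_tube h.pos (hc.mem _)))
    (fun δ hδ => by rw [h0]; exact hc.eventually_proj_symm_eq h hσ0 hδ)
  rwa [h0, hpc] at this

end ProximallySmoothCurves

/-- **Theorem.** If `S ⊆ ℝ²` is nonempty, closed, bounded, connected, has empty interior,
is proximally `C²` of some radius `r_S > 0`, and is not a singleton, then `S` is a regular
simple closed curve of class `C²`: it is a compact connected `1`-dimensional `C²` manifold
without boundary, and it admits a periodic regular injective `C²` parametrization
(hence it is `C²`-diffeomorphic to a circle). -/
theorem stmt2 (S : Set E2) (rS : ℝ) (hrS : 0 < rS)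
    (hne : S.Nonempty) (hcl : IsClosed S) (hbd : Bornology.IsBounded S)
    (hconn : IsConnected S) (hint : interior S = ∅)
    (hprox : ContDiffOn ℝ 2 (fun x => infDist x S)
      {x | 0 < infDist x S ∧ infDist x S < rS})
    (hnotsing : ¬ ∃ p, S = {p}) :
    IsCompact S ∧ (∀ p ∈ S, IsC2GraphAt S p) ∧
    ∃ (L : ℝ) (γ : ℝ → E2), 0 < L ∧ ContDiff ℝ 2 γ ∧ Function.Periodic γ L ∧
      (∀ t : ℝ, deriv γ t ≠ 0) ∧ Set.InjOn γ (Set.Ico 0 L) ∧ Set.range γ = S := by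
  have h : ProxCurve S rS :=
    { pos := hrS
      nonempty := hne
      closed := hcl
      smooth := hprox
      bounded := hbd
      conn := hconn.isPreconnected
      interior_eq := hint
      not_singleton := hnotsing }
  refine ⟨isCompact_of_isClosed_isBounded hcl hbd, fun p hp => h.isC2GraphAt hp, ?_⟩
  obtain ⟨p, hp⟩ := hne
  obtain ⟨v, hv⟩ := h.exists_isNormal_of_mem hint hp
  obtain ⟨c, hc, -⟩ := h.exists_isLevelCurve (hv.mem_level hrS)
  obtain ⟨σ, hmono, hσ0, hσ⟩ := hc.exists_arclength h
  obtain ⟨L, hL, hper, hinj⟩ := hc.exists_period_proj_symm h hmono hσ0 hσ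
  refine ⟨L, _, hL, hc.contDiff_proj_symm h hσ, hper, fun t ht => ?_, hinj, hc.range_proj_symm h⟩
  have h1 := hc.norm_distGrad h (σ.symm t)
  rw [← norm_rot, ← (hc.hasDerivAt_proj_symm h hσ t).deriv, ht, norm_zero] at h1
  norm_num at h1
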